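/- For every integer l ≥ 1 there exists a constant C > 0, depending only on Ω, r, u, κ and l, such that for every f ∈ C^∞ on the closure of Ω: ‖f‖_{H^{2l, 1/(2κ)+l-1/2}} ≤ C ( ‖L̃_1 f‖_{H^{2l-2, 1/(2κ)+l-3/2}} + ‖f‖_{H^{0, 1/(2κ)-1/2}} ). -/

import Mathlib

open Set MeasureTheory

/-- Partial derivative in the `i`-th coordinate direction. -/
noncomputable def pd {n : ℕ} (i : Fin n) (f : (Fin n → ℝ) → ℝ) : (Fin n → ℝ) → ℝ :=
  fun x => fderiv ℝ f x (Pi.single i 1)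

/-- Iterated partial derivative `∂^β f` for an (ordered) multi-index `β` of length `k`. -/
noncomputable def mderiv {n k : ℕ} (β : Fin k → Fin n) (f : (Fin n → ℝ) → ℝ) :
    (Fin n → ℝ) → ℝ :=
  (List.ofFn β).foldr pd f

/-- `Ω` has a smooth boundary: it is the superlevel set of a smooth defining function whose
gradient does not vanish on the boundary. -/
def HasSmoothBoundary {n : ℕ} (Ω : Set (Fin n → ℝ)) : Prop :=
  ∃ ρ : (Fin n → ℝ) → ℝ, ContDiff ℝ (⊤ : ℕ∞) ρ ∧ Ω = {x | 0 < ρ x} ∧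
    ∀ x ∈ frontier Ω, ρ x = 0 ∧ fderiv ℝ ρ x ≠ 0

/-- The matrix field `H^{ij} = δ^{ij} - u^i u^j / (u^0)²`. -/
noncomputable def Hcoef (u : (Fin 3 → ℝ) → Fin 4 → ℝ) (i j : Fin 3)
    (x : Fin 3 → ℝ) : ℝ :=
  (if i = j then (1:ℝ) else 0) - u x i.succ * u x j.succ / (u x 0) ^ 2

/-- The degenerate elliptic operator
`L̃₁ f = (κ+1) H^{ij} (r ∂_i ∂_j f + (1/κ)(∂_i r)(∂_j f))`. -/
noncomputable def L1t (κ : ℝ) (r : (Fin 3 → ℝ) → ℝ) (u : (Fin 3 → ℝ) → Fin 4 → ℝ)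
    (f : (Fin 3 → ℝ) → ℝ) (x : Fin 3 → ℝ) : ℝ :=
  (κ + 1) * ∑ i, ∑ j, Hcoef u i j x *
    (r x * pd i (pd j f) x + (1/κ) * pd i r x * pd j f x)

/-- The weighted elliptic operator (up to sign, `L̂₁` of the paper)
`A f = -(κ+1) r^{1-1/κ} ∂_i (r^{1/κ} H^{ij} ∂_j f)`. -/
noncomputable def Aop (κ : ℝ) (r : (Fin 3 → ℝ) → ℝ) (u : (Fin 3 → ℝ) → Fin 4 → ℝ)
    (f : (Fin 3 → ℝ) → ℝ) (x : Fin 3 → ℝ) : ℝ :=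
  -(κ + 1) * r x ^ ((1:ℝ) - 1/κ) *
    ∑ i, pd i (fun y => r y ^ (1/κ) * ∑ j, Hcoef u i j y * pd j f y) x

/-- The weighted Sobolev norm with weight `r`:
`‖f‖_{H^{j,σ}}² = Σ_{|β| ≤ j} ∫_Ω r^{2σ} |∂^β f|² dx`. -/
noncomputable def rSobNorm (Ω : Set (Fin 3 → ℝ)) (r : (Fin 3 → ℝ) → ℝ) (j : ℕ) (σ : ℝ)
    (f : (Fin 3 → ℝ) → ℝ) : ℝ :=
  Real.sqrt (∑ k ∈ Finset.range (j + 1), ∑ β : Fin k → Fin 3,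
    ∫ x in Ω, r x ^ (2 * σ) * (mderiv β f x) ^ 2)

/-- A commutative algebra `A` of bounded functions on `X` (evaluated through `ev`), with three
commuting derivations `D`, a positive weight `r` whose powers of exponent `> -1` are integrable,
a weighted divergence theorem, and a uniformly elliptic symmetric matrix `H`. -/
structure WeightedCalculus (X A : Type*) [MeasurableSpace X] [CommRing A] [Algebra ℝ A] where
  μ : Measure X
  ev : X → A →ₐ[ℝ] ℝ
  D : Fin 3 → Derivation ℝ A A
  D_comm : ∀ i j f, D i (D j f) = D j (D i f)
  r : A
  r_pos : ∀ x, 0 < ev x r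
  bdd : ∀ f, ∃ C, ∀ x, |ev x f| ≤ C
  meas : ∀ f, AEStronglyMeasurable (fun x => ev x f) μ
  integ : ∀ s : ℝ, -1 < s → Integrable (fun x => (ev x r) ^ s) μ
  ibp : ∀ s : ℝ, -1 < s → ∀ i f,
    ∫ x, (ev x r) ^ s * ev x (r * D i f + algebraMap ℝ A (s + 1) * (D i r * f)) ∂μ = 0
  grad : ∃ c > 0, ∀ x, c ≤ ∑ i, (ev x (D i r)) ^ 2 + ev x r
  H : Fin 3 → Fin 3 → A
  H_symm : ∀ i j, H i j = H j i
  H_ell : ∃ c > 0, ∀ x, ∀ ξ : Fin 3 → ℝ, c * ∑ i, ξ i ^ 2 ≤ ∑ i, ∑ j, ev x (H i j) * (ξ i * ξ j)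

namespace WeightedCalculus

variable {X A : Type*} [MeasurableSpace X] [CommRing A] [Algebra ℝ A] (S : WeightedCalculus X A)

/-- The weighted integral `∫ r^s f`. -/
noncomputable def I (s : ℝ) (f : A) : ℝ := ∫ x, (S.ev x S.r) ^ s * S.ev x f ∂S.μ

/-- The weighted divergence of a vector field. -/
noncomputable def dv (s : ℝ) (V : Fin 3 → A) : A :=
  ∑ i, (S.r * S.D i (V i) + algebraMap ℝ A (s + 1) * (S.D i S.r * V i))

/-- The second order elliptic operator `H^{ij} ∂_i ∂_j`. -/
noncomputable def P (f : A) : A := ∑ i, ∑ j, S.H i j * S.D i (S.D j f)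

/-- The conormal derivative `H^{ij} ∂_i r ∂_j`. -/
noncomputable def N (f : A) : A := ∑ i, ∑ j, S.H i j * S.D i S.r * S.D j f

/-- The degenerate elliptic operator `r H^{ij} ∂_i ∂_j + a H^{ij} ∂_i r ∂_j`. -/
noncomputable def L (a : ℝ) (f : A) : A := S.r * S.P f + algebraMap ℝ A a * S.N f

lemma integrable {s : ℝ} (hs : -1 < s) (f : A) :
    Integrable (fun x => (S.ev x S.r) ^ s * S.ev x f) S.μ := by
  obtain ⟨C, hC⟩ := S.bdd f
  exact (S.integ s hs).mul_bdd (S.meas f) (Filter.Eventually.of_forall fun x => by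
    simpa using hC x)

lemma I_mono {s : ℝ} (hs : -1 < s) {f g : A} (h : ∀ x, S.ev x f ≤ S.ev x g) :
    S.I s f ≤ S.I s g :=
  integral_mono (S.integrable hs f) (S.integrable hs g) fun x =>
    mul_le_mul_of_nonneg_left (h x) (Real.rpow_nonneg (S.r_pos x).le s)

lemma I_nonneg {s : ℝ} {f : A} (h : ∀ x, 0 ≤ S.ev x f) : 0 ≤ S.I s f :=
  integral_nonneg fun x => mul_nonneg (Real.rpow_nonneg (S.r_pos x).le s) (h x)

lemma I_add {s : ℝ} (hs : -1 < s) (f g : A) : S.I s (f + g) = S.I s f + S.I s g := by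
  simp only [I, map_add, mul_add]
  exact integral_add (S.integrable hs f) (S.integrable hs g)

lemma I_smul (s c : ℝ) (f : A) : S.I s (algebraMap ℝ A c * f) = c * S.I s f := by
  simp only [I, map_mul, AlgHom.commutes, Algebra.algebraMap_self, RingHom.id_apply]
  rw [← integral_const_mul]
  congr 1; ext x; ring

lemma I_sum {ι : Type*} (t : Finset ι) {s : ℝ} (hs : -1 < s) (f : ι → A) :
    S.I s (∑ i ∈ t, f i) = ∑ i ∈ t, S.I s (f i) := by
  simp only [I, map_sum, Finset.mul_sum]
  exact integral_finsetSum _ fun i _ => S.integrable hs (f i)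

lemma I_r_mul (s : ℝ) (f : A) : S.I s (S.r * f) = S.I (s + 1) f := by
  simp only [I, map_mul]
  congr 1; ext x
  rw [Real.rpow_add_one (S.r_pos x).ne']; ring

lemma I_rr_mul (s : ℝ) (f : A) : S.I s (S.r ^ 2 * f) = S.I (s + 2) f := by
  rw [pow_two, mul_assoc, I_r_mul, I_r_mul]; congr 1; ring

lemma I_dv {s : ℝ} (hs : -1 < s) (V : Fin 3 → A) : S.I s (S.dv s V) = 0 := by
  rw [dv, I_sum S _ hs]
  exact Finset.sum_eq_zero fun i _ => S.ibp s hs i (V i)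

/-- A pointwise inequality modulo a weighted divergence integrates. -/
lemma I_le_of_dv {s : ℝ} (hs : -1 < s) {f g : A} (V : Fin 3 → A)
    (h : ∀ x, S.ev x f ≤ S.ev x g + S.ev x (S.dv s V)) : S.I s f ≤ S.I s g := by
  have := S.I_mono hs (f := f) (g := g + S.dv s V) (by simpa using h)
  rwa [S.I_add hs, S.I_dv hs, add_zero] at this

lemma I_le_mul {s : ℝ} (hs : -1 < s) {f g : A} (c : ℝ)
    (h : ∀ x, S.ev x f ≤ c * S.ev x g) : S.I s f ≤ c * S.I s g := by
  rw [← I_smul]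
  exact S.I_mono hs (by simpa using h)

lemma bdd_pos (f : A) : ∃ C > 0, ∀ x, S.ev x f ≤ C := by
  obtain ⟨C, hC⟩ := S.bdd f
  exact ⟨max C 1, by positivity, fun x => (le_abs_self _).trans ((hC x).trans (le_max_left _ _))⟩

/-- Cauchy–Schwarz for a bilinear form with coefficients in `A`. -/
lemma bilin_bound {ι κ : Type*} [Fintype ι] [Fintype κ] (K : ι → κ → A) :
    ∃ M > 0, ∀ x, ∀ (ξ : ι → ℝ) (η : κ → ℝ),
      (∑ i, ∑ k, S.ev x (K i k) * (ξ i * η k)) ^ 2 ≤ M * (∑ i, ξ i ^ 2) * ∑ k, η k ^ 2 := by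
  obtain ⟨M, hM, h⟩ := S.bdd_pos (∑ p : ι × κ, K p.1 p.2 ^ 2)
  refine ⟨M, hM, fun x ξ η => ?_⟩
  have h1 := Finset.sum_mul_sq_le_sq_mul_sq Finset.univ (fun p : ι × κ => S.ev x (K p.1 p.2))
    (fun p => ξ p.1 * η p.2)
  have h2 := h x
  simp only [map_sum, map_pow] at h2
  have h3 : ∑ p : ι × κ, (ξ p.1 * η p.2) ^ 2 = (∑ i, ξ i ^ 2) * ∑ k, η k ^ 2 := by
    simp only [mul_pow, Fintype.sum_prod_type, Finset.sum_mul_sum]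
  rw [h3, Fintype.sum_prod_type] at h1
  have h4 : 0 ≤ (∑ i, ξ i ^ 2) * ∑ k, η k ^ 2 := by positivity
  rw [mul_assoc]
  exact h1.trans (mul_le_mul_of_nonneg_right h2 h4)

lemma lin_bound {ι : Type*} [Fintype ι] (K : ι → A) :
    ∃ M > 0, ∀ x, ∀ (ξ : ι → ℝ),
      (∑ i, S.ev x (K i) * ξ i) ^ 2 ≤ M * ∑ i, ξ i ^ 2 := by
  obtain ⟨M, hM, h⟩ := S.bilin_bound (κ := Unit) (fun i _ => K i)
  exact ⟨M, hM, fun x ξ => by simpa using h x ξ (fun _ => 1)⟩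

end WeightedCalculus

lemma le_add_of_sq_le {z M a b ε : ℝ} (hM : 0 < M) (ha : 0 ≤ a) (hb : 0 ≤ b) (hε : 0 < ε)
    (h : z ^ 2 ≤ M * a * b) : z ≤ ε * a + M / (4 * ε) * b := by
  apply le_of_sq_le_sq _ (by positivity)
  have : M * a * b = 4 * (ε * a) * (M / (4 * ε) * b) := by field_simp
  nlinarith [sq_nonneg (ε * a - M / (4 * ε) * b)]

namespace WeightedCalculus

variable {X A : Type*} [MeasurableSpace X] [CommRing A] [Algebra ℝ A] (S : WeightedCalculus X A)

/-- The squared length of the gradient. -/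
noncomputable def gradSq (f : A) : A := ∑ i, S.D i f ^ 2

/-- The squared length of the Hessian. -/
noncomputable def hessSq (f : A) : A := ∑ i, ∑ j, S.D i (S.D j f) ^ 2

lemma ev_gradSq (x : X) (f : A) : S.ev x (S.gradSq f) = ∑ i, S.ev x (S.D i f) ^ 2 := by
  simp [gradSq]

lemma ev_hessSq (x : X) (f : A) :
    S.ev x (S.hessSq f) = ∑ p : Fin 3 × Fin 3, S.ev x (S.D p.1 (S.D p.2 f)) ^ 2 := by
  simp [hessSq, Fintype.sum_prod_type]

lemma gradSq_nonneg (x : X) (f : A) : 0 ≤ S.ev x (S.gradSq f) := by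
  rw [ev_gradSq]; positivity

lemma hessSq_nonneg (x : X) (f : A) : 0 ≤ S.ev x (S.hessSq f) := by
  rw [ev_hessSq]; positivity

lemma ev_N (x : X) (f : A) :
    S.ev x (S.N f) = ∑ j, S.ev x (∑ i, S.H i j * S.D i S.r) * S.ev x (S.D j f) := by
  rw [N, Finset.sum_comm]
  simp [Finset.sum_mul]

lemma N_sq_le : ∃ M > 0, ∀ f x, S.ev x (S.N f) ^ 2 ≤ M * S.ev x (S.gradSq f) := by
  obtain ⟨M, hM, h⟩ := S.lin_bound (fun j => ∑ i, S.H i j * S.D i S.r)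
  exact ⟨M, hM, fun f x => by rw [ev_N, ev_gradSq]; exact h x _⟩

/-- Hardy's inequality. -/
lemma hardy {s : ℝ} (hs : -1 < s) :
    ∃ C > 0, ∀ f, S.I s (f ^ 2) ≤ C * S.I s (S.r ^ 2 * (f ^ 2 + S.gradSq f)) := by
  obtain ⟨c, hc, hgrad⟩ := S.grad
  obtain ⟨M₁, hM₁, h₁⟩ := S.bdd_pos (-∑ i, S.D i (S.D i S.r))
  obtain ⟨M, hM, h₂⟩ := S.lin_bound (fun i => S.D i S.r)
  set δ := (s + 1) * c with hδ
  have hδ0 : 0 < δ := mul_pos (by linarith) hc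
  set K := M₁ + (s + 1) with hK
  have hK0 : 0 < K := by rw [hK]; linarith
  refine ⟨(2 / δ) * (K ^ 2 / δ + 4 * M / δ), by positivity, fun f => ?_⟩
  have key := S.I_le_of_dv hs (f := algebraMap ℝ A (δ / 2) * f ^ 2)
    (g := algebraMap ℝ A (K ^ 2 / δ + 4 * M / δ) * (S.r ^ 2 * (f ^ 2 + S.gradSq f)))
    (fun i => S.D i S.r * f ^ 2) ?_
  · rw [I_smul, I_smul] at key
    have : S.I s (f ^ 2) = (2 / δ) * (δ / 2 * S.I s (f ^ 2)) := by field_simp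
    rw [this, mul_assoc]
    exact mul_le_mul_of_nonneg_left key (by positivity)
  intro x
  have hd : S.dv s (fun i => S.D i S.r * f ^ 2) =
      S.r * (∑ i, S.D i (S.D i S.r)) * f ^ 2 + 2 * S.r * f * (∑ i, S.D i S.r * S.D i f)
       + algebraMap ℝ A (s + 1) * (∑ i, S.D i S.r ^ 2) * f ^ 2 := by
    simp only [dv, Fin.sum_univ_three, Derivation.leibniz, pow_two, smul_eq_mul]
    ring
  rw [hd]
  have e₁ := h₁ x
  have e₂ := h₂ x (fun i => S.ev x (S.D i f))
  have e₃ := hgrad x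
  rw [← ev_gradSq] at e₂
  have hr := S.r_pos x
  have hG := S.gradSq_nonneg x f
  simp only [map_mul, map_add, map_pow, AlgHom.commutes, Algebra.algebraMap_self, RingHom.id_apply,
    map_sum, map_neg, map_ofNat] at e₁ e₂ e₃ ⊢
  set F := S.ev x f
  set ρ := S.ev x S.r
  set Δ := ∑ i, S.ev x (S.D i (S.D i S.r))
  set Y := ∑ i, S.ev x (S.D i S.r) * S.ev x (S.D i f)
  set G := S.ev x (S.gradSq f)
  set Q := ∑ i, S.ev x (S.D i S.r) ^ 2
  have a1 : -(ρ * Δ * F ^ 2) ≤ M₁ * ρ * F ^ 2 := by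
    nlinarith [mul_le_mul_of_nonneg_left e₁ (by positivity : 0 ≤ ρ * F ^ 2)]
  have a2 : (s + 1) * c * F ^ 2 ≤ (s + 1) * Q * F ^ 2 + (s + 1) * ρ * F ^ 2 := by
    have := mul_le_mul_of_nonneg_left e₃ (by nlinarith [sq_nonneg F] : 0 ≤ (s + 1) * F ^ 2)
    nlinarith
  have a3 : K * ρ * F ^ 2 ≤ δ / 4 * F ^ 2 + K ^ 2 / δ * (ρ ^ 2 * F ^ 2) := by
    have : δ / 4 * F ^ 2 + K ^ 2 / δ * (ρ ^ 2 * F ^ 2) - K * ρ * F ^ 2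
      = δ * (F / 2 - K * ρ * F / δ) ^ 2 := by field_simp; ring
    nlinarith [mul_nonneg hδ0.le (sq_nonneg (F / 2 - K * ρ * F / δ))]
  have a4 : -(2 * ρ * F * Y) ≤ δ / 4 * F ^ 2 + 4 / δ * (ρ ^ 2 * Y ^ 2) := by
    have : δ / 4 * F ^ 2 + 4 / δ * (ρ ^ 2 * Y ^ 2) + 2 * ρ * F * Y
      = δ * (F / 2 + 2 * ρ * Y / δ) ^ 2 := by field_simp; ring
    nlinarith [mul_nonneg hδ0.le (sq_nonneg (F / 2 + 2 * ρ * Y / δ))]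
  have a5 : 4 / δ * (ρ ^ 2 * Y ^ 2) ≤ 4 * M / δ * (ρ ^ 2 * G) := by
    have := mul_le_mul_of_nonneg_left e₂ (by positivity : 0 ≤ 4 / δ * ρ ^ 2)
    calc _ = 4 / δ * ρ ^ 2 * Y ^ 2 := by ring
      _ ≤ _ := this
      _ = _ := by ring
  have a6 : 0 ≤ K ^ 2 / δ * (ρ ^ 2 * G) := by positivity
  have a7 : 0 ≤ 4 * M / δ * (ρ ^ 2 * F ^ 2) := by positivity
  have a8 : K * ρ * F ^ 2 = M₁ * ρ * F ^ 2 + (s + 1) * ρ * F ^ 2 := by rw [hK]; ring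
  rw [← hδ] at a2
  linarith

end WeightedCalculus

namespace WeightedCalculus

variable {X A : Type*} [MeasurableSpace X] [CommRing A] [Algebra ℝ A] (S : WeightedCalculus X A)

/-- The energy estimate, from testing `L b f` against `f`. -/
lemma energy {b : ℝ} (hb : 0 < b) :
    ∃ C > 0, ∀ f, S.I (b - 1) (S.r * S.gradSq f) ≤ C * S.I (b - 1) (S.L b f ^ 2 + f ^ 2) := by
  obtain ⟨c, hc, hell⟩ := S.H_ell
  obtain ⟨M, hM, h₁⟩ := S.lin_bound (fun j => ∑ i, S.D i (S.H i j))
  obtain ⟨R, hR, h₂⟩ := S.bdd_pos S.r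
  set K := 1 + R * (M / (4 * (c / 2))) with hK
  have hK0 : 0 < K := by positivity
  refine ⟨(2 / c) * K, by positivity, fun f => ?_⟩
  have key := S.I_le_of_dv (s := b - 1) (by linarith)
    (f := algebraMap ℝ A (c / 2) * (S.r * S.gradSq f))
    (g := algebraMap ℝ A K * (S.L b f ^ 2 + f ^ 2))
    (fun i => (∑ j, S.H i j * S.D j f) * f) ?_
  · rw [I_smul, I_smul] at key
    have : S.I (b - 1) (S.r * S.gradSq f) = (2 / c) * (c / 2 * S.I (b - 1) (S.r * S.gradSq f)) := by
      field_simp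
    rw [this, mul_assoc]
    exact mul_le_mul_of_nonneg_left key (by positivity)
  intro x
  have hd : S.dv (b - 1) (fun i => (∑ j, S.H i j * S.D j f) * f) =
      S.L b f * f + S.r * (∑ j, (∑ i, S.D i (S.H i j)) * S.D j f) * f
       + S.r * ∑ i, ∑ j, S.H i j * (S.D i f * S.D j f) := by
    simp only [dv, L, P, N, Fin.sum_univ_three, Derivation.leibniz, smul_eq_mul, map_add,
      sub_add_cancel]
    ring
  rw [hd]
  have e₁ := h₁ x (fun i => S.ev x (S.D i f))
  have e₂ := h₂ x
  have e₃ := hell x (fun i => S.ev x (S.D i f))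
  rw [← ev_gradSq] at e₁ e₃
  have hr := S.r_pos x
  have hG := S.gradSq_nonneg x f
  simp only [map_mul, map_add, map_pow, AlgHom.commutes, Algebra.algebraMap_self, RingHom.id_apply,
    map_sum] at e₁ e₂ e₃ ⊢
  set F := S.ev x f
  set ρ := S.ev x S.r
  set g := S.ev x (S.L b f)
  set Y := ∑ i, (∑ j, S.ev x (S.D j (S.H j i))) * S.ev x (S.D i f)
  set G := S.ev x (S.gradSq f)
  set Q := ∑ i, ∑ j, S.ev x (S.H i j) * (S.ev x (S.D i f) * S.ev x (S.D j f))
  have a1 : -(Y * F) ≤ c / 2 * G + M / (4 * (c / 2)) * F ^ 2 :=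
    le_add_of_sq_le hM hG (sq_nonneg F) (by positivity)
      (by nlinarith [mul_le_mul_of_nonneg_right e₁ (sq_nonneg F)])
  have a2 := mul_le_mul_of_nonneg_left a1 hr.le
  have a3 := mul_le_mul_of_nonneg_left e₃ hr.le
  have a4 : ρ * (M / (4 * (c / 2)) * F ^ 2) ≤ R * (M / (4 * (c / 2))) * F ^ 2 := by
    rw [mul_assoc]
    exact mul_le_mul_of_nonneg_right e₂ (by positivity)
  have a5 : 0 ≤ R * (M / (4 * (c / 2))) * g ^ 2 := by positivity
  rw [hK]
  nlinarith [sq_nonneg (g + F), sq_nonneg g, sq_nonneg F]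

/-- The Rellich identity estimate, from testing `L b f` against `∇r · ∇f`. -/
lemma rellich {b : ℝ} (hb : 0 < b) :
    ∃ C > 0, ∀ f, S.I (b - 1) (S.gradSq f) ≤ C * S.I (b - 1) (S.L b f ^ 2 + f ^ 2) := by
  obtain ⟨c, hc, hell⟩ := S.H_ell
  obtain ⟨c', hc', hgrad⟩ := S.grad
  obtain ⟨C, hC, hE⟩ := S.energy hb
  obtain ⟨M, hM, h₁⟩ := S.bilin_bound (fun j k =>
    2 * ((∑ i, S.D i (S.H i j)) * S.D k S.r) + 2 * (∑ i, S.H i j * S.D i (S.D k S.r))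
    - (∑ l, S.D l (S.D l S.r)) * S.H j k - (∑ l, S.D l S.r * S.D l (S.H j k)))
  set δ := b * c with hδ
  have hδ0 : 0 < δ := by positivity
  set K := M / (4 * 1) + 1 + δ with hK
  have hK0 : 0 < K := by positivity
  refine ⟨(2 / (δ * c')) * (2 / δ + K * C), by positivity, fun f => ?_⟩
  have key := S.I_le_of_dv (s := b - 1) (by linarith)
    (f := algebraMap ℝ A (δ * c' / 2) * S.gradSq f)
    (g := algebraMap ℝ A (2 / δ) * (S.L b f ^ 2 + f ^ 2)
      + algebraMap ℝ A K * (S.r * S.gradSq f))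
    (fun i => S.D i S.r * (∑ j, ∑ k, S.H j k * (S.D j f * S.D k f))
      - 2 * ((∑ j, S.H i j * S.D j f) * (∑ k, S.D k S.r * S.D k f))) ?_
  · rw [I_add S (by linarith), I_smul, I_smul, I_smul] at key
    have h3 := mul_le_mul_of_nonneg_left (hE f) hK0.le
    have : S.I (b - 1) (S.gradSq f)
        = (2 / (δ * c')) * (δ * c' / 2 * S.I (b - 1) (S.gradSq f)) := by
      field_simp
    rw [this, mul_assoc (2 / (δ * c'))]
    have h4 : δ * c' / 2 * S.I (b - 1) (S.gradSq f)
        ≤ (2 / δ + K * C) * S.I (b - 1) (S.L b f ^ 2 + f ^ 2) := by linarith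
    exact mul_le_mul_of_nonneg_left h4 (by positivity)
  intro x
  have hd : S.dv (b - 1) (fun i => S.D i S.r * (∑ j, ∑ k, S.H j k * (S.D j f * S.D k f))
      - 2 * ((∑ j, S.H i j * S.D j f) * (∑ k, S.D k S.r * S.D k f))) =
      - (2 * S.L b f * (∑ k, S.D k S.r * S.D k f))
      + algebraMap ℝ A b * (∑ i, S.D i S.r ^ 2) * (∑ j, ∑ k, S.H j k * (S.D j f * S.D k f))
      - S.r * ∑ j, ∑ k, (2 * ((∑ i, S.D i (S.H i j)) * S.D k S.r)
        + 2 * (∑ i, S.H i j * S.D i (S.D k S.r))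
        - (∑ l, S.D l (S.D l S.r)) * S.H j k - (∑ l, S.D l S.r * S.D l (S.H j k)))
          * (S.D j f * S.D k f) := by
    simp only [dv, L, P, N, Fin.sum_univ_three, two_mul, Derivation.leibniz, smul_eq_mul, map_add,
      map_sub, sub_add_cancel, S.H_symm 1 0, S.H_symm 2 0, S.H_symm 2 1,
      S.D_comm 1 0, S.D_comm 2 0, S.D_comm 2 1]
    ring
  rw [hd]
  have e₁ := h₁ x (fun i => S.ev x (S.D i f)) (fun i => S.ev x (S.D i f))
  have e₂ := Finset.sum_mul_sq_le_sq_mul_sq Finset.univ (fun i => S.ev x (S.D i S.r))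
    (fun i => S.ev x (S.D i f))
  have e₃ := hell x (fun i => S.ev x (S.D i f))
  have e₄ := hgrad x
  rw [← ev_gradSq S x f] at e₁ e₂ e₃
  have hr := S.r_pos x
  have hG := S.gradSq_nonneg x f
  simp only [map_mul, map_add, map_sub, map_neg, map_ofNat, map_pow, AlgHom.commutes,
    Algebra.algebraMap_self, RingHom.id_apply, map_sum] at e₁ e₂ e₃ e₄ ⊢
  set F := S.ev x f
  set ρ := S.ev x S.r
  set g := S.ev x (S.L b f)
  set Y := ∑ i, S.ev x (S.D i S.r) * S.ev x (S.D i f)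
  set G := S.ev x (S.gradSq f)
  set Q := ∑ i, ∑ j, S.ev x (S.H i j) * (S.ev x (S.D i f) * S.ev x (S.D j f))
  set T := ∑ i, S.ev x (S.D i S.r) ^ 2
  set Z := ∑ i, ∑ j, (_ : ℝ) * (S.ev x (S.D i f) * S.ev x (S.D j f))
  have hT : 0 ≤ T := by positivity
  have a1 : Z ≤ 1 * G + M / (4 * 1) * G := le_add_of_sq_le hM hG hG one_pos e₁
  have a2 := mul_le_mul_of_nonneg_left a1 hr.le
  have a3 : δ * (T * G) ≤ b * T * Q := by
    have := mul_le_mul_of_nonneg_left e₃ (by positivity : 0 ≤ b * T)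
    rw [hδ]; linarith
  have a4 : δ * c' * G ≤ δ * (T * G) + δ * (ρ * G) := by
    have := mul_le_mul_of_nonneg_left e₄ (by positivity : 0 ≤ δ * G)
    linarith
  have a5 : 2 * g * Y ≤ 2 / δ * g ^ 2 + δ / 2 * Y ^ 2 := by
    have : 2 / δ * g ^ 2 + δ / 2 * Y ^ 2 - 2 * g * Y = δ / 2 * (2 * g / δ - Y) ^ 2 := by
      field_simp; ring
    have h0 : 0 ≤ δ / 2 * (2 * g / δ - Y) ^ 2 := by positivity
    linarith
  have a6 : δ / 2 * Y ^ 2 ≤ δ / 2 * (T * G) := mul_le_mul_of_nonneg_left e₂ (by positivity)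
  have a7 : 0 ≤ 2 / δ * F ^ 2 := by positivity
  have a8 : 0 ≤ δ * (ρ * G) := by positivity
  rw [hK]
  nlinarith

lemma hess_pointwise {c ε R M₁ M₂ M₃ M₄ b ρ g n G W Δ Q Y Z₁ Z₂ : ℝ} (hR : 0 < R)
    (hM₁ : 0 < M₁) (hM₂ : 0 < M₂) (hM₃ : 0 < M₃) (hM₄ : 0 < M₄) (hε : ε = c / 6) (hε0 : 0 < ε)
    (e₇ : ρ ^ 2 ≤ R) (hG : 0 ≤ G) (hW : 0 ≤ W) (e₄ : n ^ 2 ≤ M₄ * G) (e₆ : Δ ^ 2 ≤ 3 * W)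
    (e₅ : c * W ≤ Q) (e₃ : Y ^ 2 ≤ M₃ * G) (e₁ : Z₁ ^ 2 ≤ M₁ * W * G)
    (e₂ : Z₂ ^ 2 ≤ M₂ * W * G) :
    c / 2 * (ρ ^ 2 * W) ≤
      (R * (M₁ / (4 * ε)) + M₂ / (4 * ε) + M₃ + (3 / (4 * ε) + 1) * (2 + 2 * b ^ 2 * M₄))
        * (g ^ 2 + G)
      + (ρ ^ 2 * Q + ρ ^ 2 * Z₁ + ρ * Z₂ - (g - b * n) * (ρ * Δ) - (g - b * n) * Y) := by
  have b1 : -Z₁ ≤ ε * W + M₁ / (4 * ε) * G := le_add_of_sq_le hM₁ hW hG hε0 (by rwa [neg_sq])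
  have b2 := mul_le_mul_of_nonneg_left b1 (sq_nonneg ρ)
  have b3 : ρ ^ 2 * (M₁ / (4 * ε) * G) ≤ R * (M₁ / (4 * ε)) * G := by
    rw [mul_assoc]
    exact mul_le_mul_of_nonneg_right e₇ (by positivity)
  have b4 : -(ρ * Z₂) ≤ ε * (ρ ^ 2 * W) + M₂ / (4 * ε) * G :=
    le_add_of_sq_le hM₂ (by positivity) hG hε0
      (by nlinarith [mul_le_mul_of_nonneg_left e₂ (sq_nonneg ρ)])
  obtain ⟨m, hm⟩ : ∃ m, m = g - b * n := ⟨_, rfl⟩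
  rw [← hm]
  have b5 : m * (ρ * Δ) ≤ ε * (ρ ^ 2 * W) + 3 / (4 * ε) * m ^ 2 :=
    le_add_of_sq_le three_pos (by positivity) (sq_nonneg m) hε0
      (by nlinarith [mul_le_mul_of_nonneg_left e₆ (sq_nonneg (ρ * m))])
  have b6 : m * Y ≤ m ^ 2 + M₃ * G := by nlinarith [sq_nonneg (m - Y / 2)]
  have b7 : m ^ 2 ≤ (2 + 2 * b ^ 2 * M₄) * (g ^ 2 + G) := by
    have b8 := mul_le_mul_of_nonneg_left e₄ (sq_nonneg b)
    have b9 : 0 ≤ b ^ 2 * M₄ * g ^ 2 := by positivity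
    rw [hm]
    nlinarith [sq_nonneg (g + b * n)]
  have b8 := mul_le_mul_of_nonneg_left b7 (by positivity : 0 ≤ 3 / (4 * ε) + 1)
  have b9 : 0 ≤ (R * (M₁ / (4 * ε)) + M₂ / (4 * ε) + M₃) * g ^ 2 := by positivity
  have b10 : c / 2 * (ρ ^ 2 * W) = c * (ρ ^ 2 * W) - 3 * (ε * (ρ ^ 2 * W)) := by rw [hε]; ring
  have b11 : ρ ^ 2 * (c * W) ≤ ρ ^ 2 * Q := mul_le_mul_of_nonneg_left e₅ (sq_nonneg ρ)
  rw [b10]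
  linarith

/-- The weighted second derivative estimate. -/
lemma hess_estimate {b : ℝ} (hb : 0 < b) :
    ∃ C > 0, ∀ f, S.I (b - 1) (S.r ^ 2 * S.hessSq f)
      ≤ C * S.I (b - 1) (S.L b f ^ 2 + S.gradSq f) := by
  obtain ⟨c, hc, hell⟩ := S.H_ell
  obtain ⟨R, hR, hRr⟩ := S.bdd_pos (S.r ^ 2)
  obtain ⟨M₁, hM₁, h₁⟩ := S.bilin_bound (fun (p : Fin 3 × Fin 3) k =>
    (if k = p.2 then ∑ i, S.D i (S.H i p.1) else 0) - S.D k (S.H p.1 p.2))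
  obtain ⟨M₂, hM₂, h₂⟩ := S.bilin_bound (fun (p : Fin 3 × Fin 3) k =>
    if k = p.2 then algebraMap ℝ A (1 + b) * ∑ i, S.D i S.r * S.H i p.1 else 0)
  obtain ⟨M₃, hM₃, h₃⟩ := S.lin_bound (fun i => algebraMap ℝ A (1 + b) * S.D i S.r)
  obtain ⟨M₄, hM₄, h₄⟩ := S.N_sq_le
  set ε := c / 6 with hε
  have hε0 : 0 < ε := by positivity
  set K := R * (M₁ / (4 * ε)) + M₂ / (4 * ε) + M₃ + (3 / (4 * ε) + 1) * (2 + 2 * b ^ 2 * M₄)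
    with hK
  have hK0 : 0 < K := by positivity
  refine ⟨(2 / c) * K, by positivity, fun f => ?_⟩
  have key := S.I_le_of_dv (s := b - 1) (by linarith)
    (f := algebraMap ℝ A (c / 2) * (S.r ^ 2 * S.hessSq f))
    (g := algebraMap ℝ A K * (S.L b f ^ 2 + S.gradSq f))
    (fun i => S.r * (∑ j, ∑ k, S.H i j * S.D j (S.D k f) * S.D k f - S.P f * S.D i f)) ?_
  · rw [I_smul, I_smul] at key
    have : S.I (b - 1) (S.r ^ 2 * S.hessSq f)
        = (2 / c) * (c / 2 * S.I (b - 1) (S.r ^ 2 * S.hessSq f)) := by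
      field_simp
    rw [this, mul_assoc]
    exact mul_le_mul_of_nonneg_left key (by positivity)
  intro x
  have hd : S.dv (b - 1) (fun i =>
      S.r * (∑ j, ∑ k, S.H i j * S.D j (S.D k f) * S.D k f - S.P f * S.D i f)) =
      S.r ^ 2 * (∑ k, ∑ i, ∑ j, S.H i j * (S.D i (S.D k f) * S.D j (S.D k f)))
      + S.r ^ 2 * (∑ p : Fin 3 × Fin 3, ∑ k,
        ((if k = p.2 then ∑ i, S.D i (S.H i p.1) else 0) - S.D k (S.H p.1 p.2)) *
          (S.D p.1 (S.D p.2 f) * S.D k f))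
      + S.r * (∑ p : Fin 3 × Fin 3, ∑ k,
        (if k = p.2 then algebraMap ℝ A (1 + b) * ∑ i, S.D i S.r * S.H i p.1 else 0) *
          (S.D p.1 (S.D p.2 f) * S.D k f))
      - S.r * S.P f * (S.r * ∑ i, S.D i (S.D i f))
      - S.r * S.P f * (∑ i, algebraMap ℝ A (1 + b) * S.D i S.r * S.D i f) := by
    simp only [dv, P, Fintype.sum_prod_type, Fin.sum_univ_three, Derivation.leibniz, smul_eq_mul,
      map_add, map_sub, sub_add_cancel, S.H_symm 1 0, S.H_symm 2 0, S.H_symm 2 1,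
      S.D_comm 1 0, S.D_comm 2 0, S.D_comm 2 1, Fin.reduceEq, if_true, if_false, map_one,
      Fin.isValue]
    ring
  rw [hd]
  have e₁ := h₁ x (fun p => S.ev x (S.D p.1 (S.D p.2 f))) (fun i => S.ev x (S.D i f))
  have e₂ := h₂ x (fun p => S.ev x (S.D p.1 (S.D p.2 f))) (fun i => S.ev x (S.D i f))
  have e₃ := h₃ x (fun i => S.ev x (S.D i f))
  have e₄ := h₄ f x
  have e₅ : c * S.ev x (S.hessSq f) ≤ ∑ k, ∑ i, ∑ j, S.ev x (S.H i j) *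
      (S.ev x (S.D i (S.D k f)) * S.ev x (S.D j (S.D k f))) := by
    rw [hessSq, Finset.sum_comm]
    simp only [map_sum, map_pow]
    rw [Finset.mul_sum]
    refine Finset.sum_le_sum fun k _ => ?_
    exact hell x (fun i => S.ev x (S.D i (S.D k f)))
  have e₆ : (∑ i, S.ev x (S.D i (S.D i f))) ^ 2 ≤ 3 * S.ev x (S.hessSq f) := by
    have := sq_sum_le_card_mul_sum_sq (s := Finset.univ)
      (f := fun i : Fin 3 => S.ev x (S.D i (S.D i f)))
    refine this.trans ?_
    simp only [Finset.card_univ, Fintype.card_fin, hessSq, map_sum, map_pow, Nat.cast_ofNat]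
    refine mul_le_mul_of_nonneg_left (Finset.sum_le_sum fun i _ => ?_) (by norm_num)
    exact Finset.single_le_sum (f := fun j => S.ev x (S.D i (S.D j f)) ^ 2)
      (fun j _ => sq_nonneg _) (Finset.mem_univ i)
  rw [← ev_gradSq S x f] at e₁ e₂ e₃
  rw [← ev_hessSq S x f] at e₁ e₂
  have e₇ := hRr x
  have hr := S.r_pos x
  have hG := S.gradSq_nonneg x f
  have hW := S.hessSq_nonneg x f
  have hg : S.ev x S.r * S.ev x (S.P f) = S.ev x (S.L b f) - b * S.ev x (S.N f) := by
    simp [L]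
  simp only [map_mul, map_add, map_sub, map_pow, map_sum (S.ev x)] at e₁ e₂ e₃ e₄ e₇ ⊢
  rw [hg]
  simp only [AlgHom.commutes, Algebra.algebraMap_self, RingHom.id_apply] at e₁ e₂ e₃ ⊢
  set ρ := S.ev x S.r
  set g := S.ev x (S.L b f)
  set n := S.ev x (S.N f)
  set G := S.ev x (S.gradSq f)
  set W := S.ev x (S.hessSq f)
  set Δ := ∑ i, S.ev x (S.D i (S.D i f))
  set Q := ∑ k, ∑ i, ∑ j, S.ev x (S.H i j) *
      (S.ev x (S.D i (S.D k f)) * S.ev x (S.D j (S.D k f)))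
  set Y := ∑ i, (_ : ℝ) * S.ev x (S.D i f)
  set Z₁ := ∑ p : Fin 3 × Fin 3, ∑ k : Fin 3, (_ - _) * (_ : ℝ)
  set Z₂ := ∑ p : Fin 3 × Fin 3, ∑ k : Fin 3, (_ : ℝ) * (_ : ℝ)
  exact hess_pointwise hR hM₁ hM₂ hM₃ hM₄ hε hε0 e₇ hG hW e₄ e₆ e₅ e₃ e₁ e₂

/-- Interpolation of the first derivatives between the function and its second derivatives. -/
lemma interpolation {b ε : ℝ} (hb : 0 < b) (hε : 0 < ε) :
    ∃ C > 0, ∀ f, S.I (b - 1) (S.r ^ 2 * S.gradSq f)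
      ≤ ε * S.I (b - 1) (S.r ^ 2 * S.hessSq f) + C * S.I (b - 1) (f ^ 2) := by
  obtain ⟨R, hR, hRr⟩ := S.bdd_pos (S.r ^ 2)
  obtain ⟨M, hM, h₁⟩ := S.lin_bound (fun i => algebraMap ℝ A (b + 1) * S.D i S.r)
  set K := M / (4 * (1 / 2)) + R * (3 / (4 * (ε / 2))) with hK
  have hK0 : 0 < K := by positivity
  refine ⟨2 * K, by positivity, fun f => ?_⟩
  have key := S.I_le_of_dv (s := b - 1) (by linarith)
    (f := algebraMap ℝ A (1 / 2) * (S.r ^ 2 * S.gradSq f))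
    (g := algebraMap ℝ A (ε / 2) * (S.r ^ 2 * S.hessSq f) + algebraMap ℝ A K * f ^ 2)
    (fun i => S.r * (f * S.D i f)) ?_
  · rw [I_add S (by linarith), I_smul, I_smul, I_smul] at key
    linarith
  intro x
  have hd : S.dv (b - 1) (fun i => S.r * (f * S.D i f)) =
      S.r ^ 2 * S.gradSq f + S.r ^ 2 * f * ∑ i, S.D i (S.D i f)
        + S.r * f * ∑ i, algebraMap ℝ A (b + 1) * S.D i S.r * S.D i f := by
    simp only [dv, gradSq, Fin.sum_univ_three, Derivation.leibniz, smul_eq_mul, sub_add_cancel,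
      map_add, map_one]
    ring
  rw [hd]
  have e₃ := h₁ x (fun i => S.ev x (S.D i f))
  have e₆ : (∑ i, S.ev x (S.D i (S.D i f))) ^ 2 ≤ 3 * S.ev x (S.hessSq f) := by
    have := sq_sum_le_card_mul_sum_sq (s := Finset.univ)
      (f := fun i : Fin 3 => S.ev x (S.D i (S.D i f)))
    refine this.trans ?_
    simp only [Finset.card_univ, Fintype.card_fin, hessSq, map_sum, map_pow, Nat.cast_ofNat]
    refine mul_le_mul_of_nonneg_left (Finset.sum_le_sum fun i _ => ?_) (by norm_num)
    exact Finset.single_le_sum (f := fun j => S.ev x (S.D i (S.D j f)) ^ 2)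
      (fun j _ => sq_nonneg _) (Finset.mem_univ i)
  rw [← ev_gradSq S x f] at e₃
  have e₇ := hRr x
  have hr := S.r_pos x
  have hG := S.gradSq_nonneg x f
  have hW := S.hessSq_nonneg x f
  simp only [map_mul, map_add, map_pow, map_sum, AlgHom.commutes, Algebra.algebraMap_self,
    RingHom.id_apply] at e₃ e₇ ⊢
  set ρ := S.ev x S.r
  set F := S.ev x f
  set G := S.ev x (S.gradSq f)
  set W := S.ev x (S.hessSq f)
  set Δ := ∑ i, S.ev x (S.D i (S.D i f))
  set Y := ∑ i, (_ : ℝ) * S.ev x (S.D i f)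
  have b1 : -(ρ * F * Y) ≤ 1 / 2 * (ρ ^ 2 * G) + M / (4 * (1 / 2)) * F ^ 2 :=
    le_add_of_sq_le hM (by positivity) (sq_nonneg F) one_half_pos
      (by nlinarith [mul_le_mul_of_nonneg_left e₃ (sq_nonneg (ρ * F))])
  have b2 : -(F * Δ) ≤ ε / 2 * W + 3 / (4 * (ε / 2)) * F ^ 2 :=
    le_add_of_sq_le three_pos hW (sq_nonneg F) (half_pos hε)
      (by nlinarith [mul_le_mul_of_nonneg_left e₆ (sq_nonneg F)])
  have b3 := mul_le_mul_of_nonneg_left b2 (sq_nonneg ρ)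
  have b4 : ρ ^ 2 * (3 / (4 * (ε / 2)) * F ^ 2) ≤ R * (3 / (4 * (ε / 2))) * F ^ 2 := by
    rw [mul_assoc]
    exact mul_le_mul_of_nonneg_right e₇ (by positivity)
  rw [hK]
  linarith

/-- The basic degenerate elliptic estimate. -/
lemma base_estimate {b : ℝ} (hb : 0 < b) :
    ∃ C > 0, ∀ f, S.I (b - 1) (S.r ^ 2 * S.hessSq f) + S.I (b - 1) (S.gradSq f)
      ≤ C * S.I (b - 1) (S.L b f ^ 2 + f ^ 2) := by
  obtain ⟨C₁, hC₁, h₁⟩ := S.rellich hb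
  obtain ⟨C₂, hC₂, h₂⟩ := S.hess_estimate hb
  refine ⟨C₂ + C₂ * C₁ + C₁, by positivity, fun f => ?_⟩
  have e₁ := h₁ f
  have e₂ := h₂ f
  have hs : -1 < b - 1 := by linarith
  rw [S.I_add hs] at e₁ e₂ ⊢
  have e₃ := mul_le_mul_of_nonneg_left e₁ hC₂.le
  have e₄ : 0 ≤ C₂ * S.I (b - 1) (f ^ 2) :=
    mul_nonneg hC₂.le (S.I_nonneg fun x => by rw [map_pow]; positivity)
  linarith

end WeightedCalculus

namespace WeightedCalculus

variable {X A : Type*} [MeasurableSpace X] [CommRing A] [Algebra ℝ A] (S : WeightedCalculus X A)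

/-- The sum of the squares of all iterated derivatives of order at most `k`. -/
noncomputable def J : ℕ → A → A
  | 0, f => f ^ 2
  | k + 1, f => f ^ 2 + ∑ i, J k (S.D i f)

/-- The iterated derivative along a word. -/
noncomputable def DW : List (Fin 3) → A → A
  | [], f => f
  | i :: β, f => DW β (S.D i f)

lemma J_nonneg (k : ℕ) (f : A) (x : X) : 0 ≤ S.ev x (S.J k f) := by
  induction k generalizing f with
  | zero => simp only [J, map_pow]; positivity
  | succ k ih =>
    simp only [J, map_add, map_pow, map_sum]
    have := Finset.sum_nonneg fun i (_ : i ∈ Finset.univ) => ih (S.D i f)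
    positivity

lemma sq_le_J (k : ℕ) (f : A) (x : X) : S.ev x f ^ 2 ≤ S.ev x (S.J k f) := by
  cases k with
  | zero => simp [J]
  | succ k =>
    simp only [J, map_add, map_pow, map_sum, le_add_iff_nonneg_right]
    exact Finset.sum_nonneg fun i _ => S.J_nonneg _ _ _

lemma J_le_succ (k : ℕ) (f : A) (x : X) : S.ev x (S.J k f) ≤ S.ev x (S.J (k + 1) f) := by
  induction k generalizing f with
  | zero => simpa [J] using S.sq_le_J 1 f x
  | succ k ih =>
    rw [J, J]
    simp only [map_add, map_pow, map_sum, add_le_add_iff_left]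
    exact Finset.sum_le_sum fun i _ => ih _

lemma J_mono {k l : ℕ} (h : k ≤ l) (f : A) (x : X) : S.ev x (S.J k f) ≤ S.ev x (S.J l f) :=
  monotone_nat_of_le_succ (fun k => S.J_le_succ k f x) h

lemma J_D_le (k : ℕ) (i : Fin 3) (f : A) (x : X) :
    S.ev x (S.J k (S.D i f)) ≤ S.ev x (S.J (k + 1) f) := by
  simp only [J, map_add, map_pow, map_sum]
  have := Finset.single_le_sum (f := fun i => S.ev x (S.J k (S.D i f)))
    (fun j _ => S.J_nonneg _ _ _) (Finset.mem_univ i)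
  nlinarith [sq_nonneg (S.ev x f)]

lemma J_add_le (k : ℕ) (f g : A) (x : X) :
    S.ev x (S.J k (f + g)) ≤ 2 * (S.ev x (S.J k f) + S.ev x (S.J k g)) := by
  induction k generalizing f g with
  | zero => simp only [J, map_add, map_pow]; nlinarith [sq_nonneg (S.ev x f - S.ev x g)]
  | succ k ih =>
    simp only [J, map_add, map_pow, map_sum]
    have : ∑ i, S.ev x (S.J k (S.D i f + S.D i g)) ≤
        2 * (∑ i, S.ev x (S.J k (S.D i f)) + ∑ i, S.ev x (S.J k (S.D i g))) := by
      rw [← Finset.sum_add_distrib, Finset.mul_sum]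
      exact Finset.sum_le_sum fun i _ => ih _ _
    nlinarith [sq_nonneg (S.ev x f - S.ev x g)]

lemma J_zero (k : ℕ) : S.J k 0 = 0 := by
  induction k with
  | zero => simp [J]
  | succ k ih => simp [J, ih]

/-- `T` is dominated by a differential operator of order `m` with coefficients in `A`. -/
def IsOp (m : ℕ) (T : A → A) : Prop :=
  ∀ k, ∃ C > 0, ∀ f x, S.ev x (S.J k (T f)) ≤ C * S.ev x (S.J (k + m) f)

lemma isOp_mul (c : A) : S.IsOp 0 (fun f => c * f) := by
  intro k
  induction k generalizing c with
  | zero =>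
    obtain ⟨C, hC, h⟩ := S.bdd_pos (c ^ 2)
    refine ⟨C, hC, fun f x => ?_⟩
    simp only [J, mul_pow, map_mul]
    exact mul_le_mul_of_nonneg_right (h x) (by rw [map_pow]; positivity)
  | succ k ih =>
    obtain ⟨C, hC, h⟩ := ih c
    have h' := fun i => ih (S.D i c)
    choose C' hC' h' using h'
    obtain ⟨C₀, hC₀, h₀⟩ := S.bdd_pos (c ^ 2)
    refine ⟨C₀ + 2 * C + 2 * ∑ i, C' i, by
      have := Finset.sum_nonneg fun i (_ : i ∈ Finset.univ) => (hC' i).le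
      linarith, fun f x => ?_⟩
    have e : ∀ i, S.ev x (S.J k (S.D i (c * f))) ≤
        2 * (C * S.ev x (S.J k (S.D i f)) + C' i * S.ev x (S.J (k + 1) f)) := by
      intro i
      rw [Derivation.leibniz, smul_eq_mul, smul_eq_mul]
      refine (S.J_add_le _ _ _ _).trans ?_
      have a := h (S.D i f) x
      have b := (h' i f x).trans (mul_le_mul_of_nonneg_left (S.J_le_succ k f x) (hC' i).le)
      rw [mul_comm f]
      simp only [add_zero] at a
      linarith
    have e' := Finset.sum_le_sum fun i (_ : i ∈ Finset.univ) => e i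
    rw [← Finset.mul_sum, Finset.sum_add_distrib, ← Finset.mul_sum, ← Finset.sum_mul] at e'
    have e₀ := mul_le_mul_of_nonneg_right (h₀ x) (sq_nonneg (S.ev x f))
    have e₁ : S.ev x (S.J (k + 1) f) = S.ev x f ^ 2 + ∑ i, S.ev x (S.J k (S.D i f)) := by
      simp [J]
    have e₂ : 0 ≤ ∑ i, S.ev x (S.J k (S.D i f)) := Finset.sum_nonneg fun i _ => S.J_nonneg _ _ _
    have e₃ : S.ev x (S.J (k + 1) (c * f))
        = S.ev x (c ^ 2) * S.ev x f ^ 2 + ∑ i, S.ev x (S.J k (S.D i (c * f))) := by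
      simp [J, mul_pow]
    simp only [add_zero]
    rw [e₃]
    nlinarith [mul_nonneg hC₀.le e₂, mul_nonneg hC.le (sq_nonneg (S.ev x f))]

variable {S}

lemma IsOp.add {m : ℕ} {T U : A → A} (hT : S.IsOp m T) (hU : S.IsOp m U) :
    S.IsOp m (fun f => T f + U f) := by
  intro k
  obtain ⟨C, hC, h⟩ := hT k
  obtain ⟨C', hC', h'⟩ := hU k
  refine ⟨2 * (C + C'), by positivity, fun f x => ?_⟩
  have := S.J_add_le k (T f) (U f) x
  linarith [h f x, h' f x]

lemma IsOp.sum {ι : Type*} (t : Finset ι) {m : ℕ} {T : ι → A → A} (hT : ∀ i, S.IsOp m (T i)) :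
    S.IsOp m (fun f => ∑ i ∈ t, T i f) := by
  classical
  induction t using Finset.induction_on with
  | empty =>
    intro k
    exact ⟨1, one_pos, fun f x => by simpa [S.J_zero] using S.J_nonneg _ _ _⟩
  | insert i t hi ih => simpa [Finset.sum_insert hi] using (hT i).add ih

lemma IsOp.comp {m n : ℕ} {T U : A → A} (hT : S.IsOp m T) (hU : S.IsOp n U) :
    S.IsOp (m + n) (fun f => T (U f)) := by
  intro k
  obtain ⟨C, hC, h⟩ := hT k
  obtain ⟨C', hC', h'⟩ := hU (k + m)
  refine ⟨C * C', by positivity, fun f x => ?_⟩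
  rw [mul_assoc, ← add_assoc]
  exact (h _ _).trans (mul_le_mul_of_nonneg_left (h' f x) hC.le)

lemma IsOp.mono {m n : ℕ} (hmn : m ≤ n) {T : A → A} (hT : S.IsOp m T) : S.IsOp n T := by
  intro k
  obtain ⟨C, hC, h⟩ := hT k
  exact ⟨C, hC, fun f x => (h f x).trans
    (mul_le_mul_of_nonneg_left (S.J_mono (by omega) f x) hC.le)⟩

variable (S)

lemma isOp_D (i : Fin 3) : S.IsOp 1 (S.D i) := fun k =>
  ⟨1, one_pos, fun f x => by simpa using S.J_D_le k i f x⟩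

lemma isOp_mul_D (c : A) (i : Fin 3) : S.IsOp 1 (fun f => c * S.D i f) := by
  simpa using (S.isOp_mul c).comp (S.isOp_D i)

lemma isOp_mul_DD (c : A) (i j : Fin 3) : S.IsOp 2 (fun f => c * S.D i (S.D j f)) := by
  simpa using (S.isOp_mul_D c i).comp (S.isOp_D j)

lemma isOp_P : S.IsOp 2 S.P :=
  IsOp.sum _ fun i => IsOp.sum _ fun j => S.isOp_mul_DD _ i j

/-- The commutator of `P` with `N` has order two. -/
lemma isOp_comm : S.IsOp 2 (fun f => S.P (S.N f) - S.N (S.P f)) := by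
  have : ∀ f, S.P (S.N f) - S.N (S.P f) = ∑ i, ∑ j, ∑ k, ∑ l,
      (S.H i j * S.D i (S.D j (S.H k l * S.D k S.r)) * S.D l f
      + S.H i j * S.D i (S.H k l * S.D k S.r) * S.D j (S.D l f)
      + S.H i j * S.D j (S.H k l * S.D k S.r) * S.D i (S.D l f)
      + -(S.H k l * S.D k S.r * S.D l (S.H i j)) * S.D i (S.D j f)) := by
    intro f
    have h1 : S.P (S.N f) = ∑ i, ∑ j, ∑ k, ∑ l,
        S.H i j * S.D i (S.D j (S.H k l * S.D k S.r * S.D l f)) := by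
      simp only [P, N, map_sum, Finset.mul_sum]
    have h2 : S.N (S.P f) = ∑ i, ∑ j, ∑ k, ∑ l,
        S.H k l * S.D k S.r * S.D l (S.H i j * S.D i (S.D j f)) := by
      simp only [P, N, map_sum, Finset.mul_sum]
      have : ∀ F : Fin 3 → Fin 3 → Fin 3 → Fin 3 → A,
          ∑ k, ∑ l, ∑ i, ∑ j, F i j k l = ∑ i, ∑ j, ∑ k, ∑ l, F i j k l := by
        intro F
        simp only [Fin.sum_univ_three]
        abel
      exact this _
    rw [h1, h2]
    simp only [← Finset.sum_sub_distrib]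
    refine Finset.sum_congr rfl fun i _ => Finset.sum_congr rfl fun j _ =>
      Finset.sum_congr rfl fun k _ => Finset.sum_congr rfl fun l _ => ?_
    generalize S.H k l * S.D k S.r = n
    have e : S.D l (S.D i (S.D j f)) = S.D i (S.D j (S.D l f)) := by
      rw [S.D_comm l i, S.D_comm l j]
    simp only [Derivation.leibniz, smul_eq_mul, map_add, e]
    ring
  simp only [this]
  refine IsOp.sum _ fun i => IsOp.sum _ fun j => IsOp.sum _ fun k => IsOp.sum _ fun l => ?_
  exact ((((S.isOp_mul_D _ _).mono one_le_two).add (S.isOp_mul_DD _ _ _)).add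
    (S.isOp_mul_DD _ _ _)).add (S.isOp_mul_DD _ _ _)

/-- `P` intertwines `L a` and `L (a + 2)` up to second order terms. -/
lemma L_P (a : ℝ) (f : A) : S.L (a + 2) (S.P f) =
    S.P (S.L a f) + -(S.P S.r * S.P f + algebraMap ℝ A a * (S.P (S.N f) - S.N (S.P f))) := by
  have h : ∀ h : A, S.P (S.r * h) = S.r * S.P h + S.P S.r * h + 2 * S.N h := by
    intro h
    simp only [P, N, Fin.sum_univ_three, Derivation.leibniz, smul_eq_mul, map_add, S.H_symm 1 0,
      S.H_symm 2 0, S.H_symm 2 1]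
    ring
  have h' : ∀ h : A, S.P (algebraMap ℝ A a * h) = algebraMap ℝ A a * S.P h := by
    intro h
    simp only [P, Derivation.leibniz, smul_eq_mul, Derivation.map_algebraMap, mul_zero,
      add_zero, Finset.mul_sum]
    exact Finset.sum_congr rfl fun i _ => Finset.sum_congr rfl fun j _ => by ring
  have h'' : S.P (S.L a f) = S.P (S.r * S.P f) + S.P (algebraMap ℝ A a * S.N f) := by
    simp only [L, P, map_add, mul_add, Finset.sum_add_distrib]
  rw [h'', h, h', L, map_add, map_ofNat]
  ring

lemma DW_add (β : List (Fin 3)) (f g : A) : S.DW β (f + g) = S.DW β f + S.DW β g := by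
  induction β generalizing f g with
  | nil => rfl
  | cons i β ih => simp [DW, ih]

lemma DW_zero (β : List (Fin 3)) : S.DW β 0 = 0 := by
  induction β with
  | nil => rfl
  | cons i β ih => simp [DW, ih]

lemma DW_sum {ι : Type*} (β : List (Fin 3)) (t : Finset ι) (f : ι → A) :
    S.DW β (∑ i ∈ t, f i) = ∑ i ∈ t, S.DW β (f i) :=
  map_sum (⟨⟨S.DW β, S.DW_zero β⟩, S.DW_add β⟩ : A →+ A) f t

lemma DW_D (β : List (Fin 3)) (i : Fin 3) (f : A) : S.DW β (S.D i f) = S.D i (S.DW β f) := by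
  induction β generalizing f with
  | nil => rfl
  | cons j β ih => rw [DW, S.D_comm, ih, DW]

lemma DW_sq_le (β : List (Fin 3)) (f : A) (x : X) :
    S.ev x (S.DW β f) ^ 2 ≤ S.ev x (S.J β.length f) := by
  induction β generalizing f with
  | nil => simp [DW, J]
  | cons i β ih => exact (ih _).trans (S.J_D_le _ _ _ _)

/-- The commutator of an iterated derivative with a multiplication operator has lower order. -/
lemma DW_mul_sub (c : A) (β : List (Fin 3)) : ∃ C > 0, ∀ f x,
    S.ev x (S.DW β (c * f) - c * S.DW β f) ^ 2 ≤ C * S.ev x (S.J (β.length - 1) f) := by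
  induction β with
  | nil => exact ⟨1, one_pos, fun f x => by simpa [DW] using S.J_nonneg _ _ _⟩
  | cons i β ih =>
    obtain ⟨C, hC, h⟩ := ih
    obtain ⟨C', hC', h'⟩ := S.isOp_mul (S.D i c) β.length
    refine ⟨2 * (C + C'), by positivity, fun f x => ?_⟩
    have e : S.DW (i :: β) (c * f) - c * S.DW (i :: β) f =
        (S.DW β (c * S.D i f) - c * S.DW β (S.D i f)) + S.DW β (S.D i c * f) := by
      simp only [DW, Derivation.leibniz, smul_eq_mul, DW_add, mul_comm f]
      ring
    have a : S.ev x (S.DW β (c * S.D i f) - c * S.DW β (S.D i f)) ^ 2 ≤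
        C * S.ev x (S.J β.length f) := by
      rcases β with _ | ⟨j, β⟩
      · simpa [DW] using mul_nonneg hC.le (S.J_nonneg _ _ _)
      · exact (h (S.D i f) x).trans (mul_le_mul_of_nonneg_left (S.J_D_le _ _ _ _) hC.le)
    have b := (S.DW_sq_le β (S.D i c * f) x).trans (h' f x)
    rw [e, map_add]
    simp only [List.length_cons, Nat.add_sub_cancel, add_zero] at b ⊢
    nlinarith [sq_nonneg (S.ev x (S.DW β (c * S.D i f) - c * S.DW β (S.D i f))
      - S.ev x (S.DW β (S.D i c * f)))]

end WeightedCalculus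

namespace WeightedCalculus

variable {X A : Type*} [MeasurableSpace X] [CommRing A] [Algebra ℝ A] (S : WeightedCalculus X A)

lemma J_succ (k : ℕ) (f : A) : S.J (k + 1) f = f ^ 2 + ∑ i, S.J k (S.D i f) := rfl

lemma J_two (f : A) : S.J 2 f = f ^ 2 + S.gradSq f + S.hessSq f := by
  simp only [J, gradSq, hessSq, Finset.sum_add_distrib, add_assoc]
  rw [Finset.sum_comm]

lemma I_J_succ {s : ℝ} (hs : -1 < s) (k : ℕ) (f : A) :
    S.I s (S.J (k + 1) f) = S.I s (f ^ 2) + ∑ i, S.I s (S.J k (S.D i f)) := by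
  rw [J_succ, S.I_add hs, S.I_sum _ hs]

lemma I_J_nonneg (s : ℝ) (k : ℕ) (f : A) : 0 ≤ S.I s (S.J k f) := S.I_nonneg (S.J_nonneg k f)

lemma I_sq_le_J {s : ℝ} (hs : -1 < s) (k : ℕ) (f : A) : S.I s (f ^ 2) ≤ S.I s (S.J k f) :=
  S.I_mono hs fun x => by simpa using S.sq_le_J k f x

lemma I_J_mono {s : ℝ} (hs : -1 < s) {k l : ℕ} (h : k ≤ l) (f : A) :
    S.I s (S.J k f) ≤ S.I s (S.J l f) :=
  S.I_mono hs fun x => S.J_mono h f x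

lemma I_add_two_le {s : ℝ} (hs : -1 < s) :
    ∃ C > 0, ∀ f, (∀ x, 0 ≤ S.ev x f) → S.I (s + 2) f ≤ C * S.I s f := by
  obtain ⟨C, hC, h⟩ := S.bdd_pos (S.r ^ 2)
  refine ⟨C, hC, fun f hf => ?_⟩
  rw [← I_rr_mul]
  refine S.I_le_mul hs _ fun x => ?_
  rw [map_mul]
  exact mul_le_mul_of_nonneg_right (h x) (hf x)

/-- Hardy's inequality for higher order weighted norms. -/
lemma hardy_J {s : ℝ} (hs : -1 < s) (k : ℕ) :
    ∃ C > 0, ∀ f, S.I s (S.J k f) ≤ C * S.I (s + 2) (S.J (k + 1) f) := by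
  have hs' : -1 < s + 2 := by linarith
  obtain ⟨C₀, hC₀, h₀⟩ := S.hardy hs
  have h₀' : ∀ f k, S.I s (f ^ 2) ≤ C₀ * S.I (s + 2) (S.J (k + 1) f) := by
    intro f k
    have := h₀ f
    rw [I_rr_mul] at this
    refine this.trans (mul_le_mul_of_nonneg_left ?_ hC₀.le)
    refine S.I_mono hs' fun x => ?_
    rw [J_succ, map_add, map_add, ev_gradSq, map_sum, map_pow]
    gcongr
    exact S.sq_le_J _ _ _
  induction k with
  | zero => exact ⟨C₀, hC₀, fun f => h₀' f 0⟩
  | succ k ih =>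
    obtain ⟨C, hC, h⟩ := ih
    refine ⟨C₀ + C, by positivity, fun f => ?_⟩
    rw [S.I_J_succ hs]
    have e := Finset.sum_le_sum fun i (_ : i ∈ Finset.univ) => h (S.D i f)
    rw [← Finset.mul_sum] at e
    have e' := S.I_J_succ hs' (k + 1) f
    have e'' : 0 ≤ S.I (s + 2) (f ^ 2) := S.I_nonneg fun x => by rw [map_pow]; positivity
    have := h₀' f (k + 1)
    nlinarith [mul_nonneg hC.le e'']

lemma hardy_iterate {s : ℝ} (hs : -1 < s) (k j : ℕ) :
    ∃ C > 0, ∀ f, S.I s (S.J k f) ≤ C * S.I (s + 2 * j) (S.J (k + j) f) := by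
  induction j with
  | zero => exact ⟨1, one_pos, fun f => by simp⟩
  | succ j ih =>
    obtain ⟨C, hC, h⟩ := ih
    obtain ⟨C', hC', h'⟩ := S.hardy_J (s := s + 2 * j) (by have := j.cast_nonneg (α := ℝ); linarith) (k + j)
    refine ⟨C * C', by positivity, fun f => ?_⟩
    rw [mul_assoc]
    refine (h f).trans (mul_le_mul_of_nonneg_left ((h' f).trans_eq ?_) hC.le)
    push_cast
    congr 2
    ring

/-- Intermediate derivatives are controlled by the highest and the lowest ones. -/
lemma interpolation_J {b ε : ℝ} (hb : 0 < b) (hε : 0 < ε) (m : ℕ) :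
    ∃ C > 0, ∀ f, S.I (b + 1) (S.J (m + 1) f) ≤
      ε * S.I (b + 1) (S.J (m + 2) f) + C * S.I (b - 1) (S.J m f) := by
  have hs : -1 < b - 1 := by linarith
  have hs' : -1 < b + 1 := by linarith
  have eb : b - 1 + 2 = b + 1 := by ring
  obtain ⟨C₀, hC₀, h₀⟩ := S.I_add_two_le hs
  rw [eb] at h₀
  have h₀' : ∀ f : A, S.I (b + 1) (f ^ 2) ≤ C₀ * S.I (b - 1) (f ^ 2) := fun f =>
    h₀ _ fun x => by rw [map_pow]; positivity
  induction m with
  | zero =>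
    obtain ⟨C, hC, h⟩ := S.interpolation hb hε
    refine ⟨C₀ + C, by positivity, fun f => ?_⟩
    have e := h f
    rw [I_rr_mul, I_rr_mul, eb] at e
    have e₁ : S.I (b + 1) (S.J 1 f) = S.I (b + 1) (f ^ 2) + S.I (b + 1) (S.gradSq f) := by
      rw [← S.I_add hs']; rfl
    have e₂ : S.I (b + 1) (S.hessSq f) ≤ S.I (b + 1) (S.J 2 f) := by
      refine S.I_mono hs' fun x => ?_
      rw [J_two, map_add, map_add, map_pow]
      linarith [sq_nonneg (S.ev x f), S.gradSq_nonneg x f]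
    have e₃ := mul_le_mul_of_nonneg_left e₂ hε.le
    have e₄ : S.J 0 f = f ^ 2 := rfl
    rw [zero_add, e₁, e₄]
    linarith [h₀' f]
  | succ m ih =>
    obtain ⟨C, hC, h⟩ := ih
    refine ⟨C₀ + C, by positivity, fun f => ?_⟩
    have e := Finset.sum_le_sum fun i (_ : i ∈ Finset.univ) => h (S.D i f)
    rw [Finset.sum_add_distrib, ← Finset.mul_sum, ← Finset.mul_sum] at e
    have e₁ := S.I_J_succ hs' (m + 1) f
    have e₂ := S.I_J_succ hs' (m + 2) f
    have e₃ := S.I_J_succ hs m f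
    have p₁ : 0 ≤ S.I (b + 1) (f ^ 2) := S.I_nonneg fun x => by rw [map_pow]; positivity
    have p₂ : 0 ≤ S.I (b - 1) (f ^ 2) := S.I_nonneg fun x => by rw [map_pow]; positivity
    have p₃ : 0 ≤ ∑ i, S.I (b - 1) (S.J m (S.D i f)) :=
      Finset.sum_nonneg fun i _ => S.I_J_nonneg _ _ _
    have := h₀' f
    rw [show m + 1 + 1 = m + 2 from rfl] at *
    rw [show m + 1 + 2 = m + 2 + 1 from rfl, e₁, e₂, e₃]
    nlinarith [mul_nonneg hε.le p₁, mul_nonneg hC.le p₂, mul_nonneg hC₀.le p₃]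

/-- A norm of order `m + 2` is controlled by the second order norms of the derivatives along
words of length `m`. -/
lemma J_le_of_words {s : ℝ} (hs : -1 < s) (m : ℕ) : ∃ C > 0, ∀ f R,
    (∀ β : List (Fin 3), β.length = m → S.I s (S.J 2 (S.DW β f)) ≤ R) →
    S.I s (S.J m f) ≤ R → S.I s (S.J (m + 2) f) ≤ C * R := by
  induction m with
  | zero => exact ⟨1, one_pos, fun f R h _ => by simpa [DW] using h [] rfl⟩
  | succ m ih =>
    obtain ⟨C, hC, h⟩ := ih
    refine ⟨1 + 3 * C, by positivity, fun f R h1 h2 => ?_⟩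
    have e : ∀ i, S.I s (S.J (m + 2) (S.D i f)) ≤ C * R := fun i =>
      h _ R (fun β hβ => h1 (i :: β) (by simp [hβ])) ((S.I_mono hs fun x => S.J_D_le _ _ _ _).trans h2)
    have e' := (S.I_sq_le_J hs (m + 1) f).trans h2
    rw [show m + 1 + 2 = m + 2 + 1 from rfl, S.I_J_succ hs, Fin.sum_univ_three]
    linarith [e 0, e 1, e 2]

lemma base_estimate_J {b : ℝ} (hb : 0 < b) : ∃ C > 0, ∀ f,
    S.I (b + 1) (S.J 2 f) ≤ C * (S.I (b - 1) (S.L b f ^ 2) + S.I (b - 1) (f ^ 2)) := by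
  have hs : -1 < b - 1 := by linarith
  have hs' : -1 < b + 1 := by linarith
  have eb : b - 1 + 2 = b + 1 := by ring
  obtain ⟨C₀, hC₀, h₀⟩ := S.I_add_two_le hs
  obtain ⟨C, hC, h⟩ := S.base_estimate hb
  rw [eb] at h₀
  refine ⟨C₀ + C₀ * C + C, by positivity, fun f => ?_⟩
  have e := h f
  rw [I_rr_mul, eb, S.I_add hs] at e
  have e₁ := h₀ (f ^ 2) fun x => by rw [map_pow]; positivity
  have e₂ := h₀ (S.gradSq f) (S.gradSq_nonneg · f)
  have e₃ : S.I (b + 1) (S.J 2 f) =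
      S.I (b + 1) (f ^ 2) + S.I (b + 1) (S.gradSq f) + S.I (b + 1) (S.hessSq f) := by
    rw [← S.I_add hs', ← S.I_add hs', J_two]
  have p₁ : 0 ≤ S.I (b - 1) (f ^ 2) := S.I_nonneg fun x => by rw [map_pow]; positivity
  have p₂ : 0 ≤ S.I (b - 1) (S.L b f ^ 2) := S.I_nonneg fun x => by rw [map_pow]; positivity
  have p₃ : 0 ≤ S.I (b + 1) (S.hessSq f) := S.I_nonneg (S.hessSq_nonneg · f)
  have p₄ : 0 ≤ S.I (b - 1) (S.gradSq f) := S.I_nonneg (S.gradSq_nonneg · f)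
  rw [e₃]
  have q₁ : S.I (b - 1) (S.gradSq f) ≤ C * (S.I (b - 1) (S.L b f ^ 2) + S.I (b - 1) (f ^ 2)) := by
    linarith
  have q₂ := mul_le_mul_of_nonneg_left q₁ hC₀.le
  nlinarith [mul_nonneg hC₀.le p₂]

end WeightedCalculus

namespace WeightedCalculus

variable {X A : Type*} [MeasurableSpace X] [CommRing A] [Algebra ℝ A] (S : WeightedCalculus X A)

/-- `T f` is pointwise dominated by the derivatives of `f` of order at most `n`. -/
def SqLe (n : ℕ) (T : A → A) : Prop :=
  ∃ C > 0, ∀ f x, S.ev x (T f) ^ 2 ≤ C * S.ev x (S.J n f)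

variable {S}

lemma SqLe.sum {ι : Type*} (t : Finset ι) {m : ℕ} {T : ι → A → A} (hT : ∀ i, S.SqLe m (T i)) :
    S.SqLe m (fun f => ∑ i ∈ t, T i f) := by
  classical
  induction t using Finset.induction_on with
  | empty => exact ⟨1, one_pos, fun f x => by simpa using S.J_nonneg _ _ _⟩
  | insert i t hi ih =>
    obtain ⟨C, hC, h⟩ := hT i
    obtain ⟨C', hC', h'⟩ := ih
    refine ⟨2 * (C + C'), by positivity, fun f x => ?_⟩
    simp only [Finset.sum_insert hi, map_add] at h' ⊢
    nlinarith [h f x, h' f x, sq_nonneg (S.ev x (T i f) - S.ev x (∑ i ∈ t, T i f))]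

variable (S)

lemma DW_algebraMap_mul (β : List (Fin 3)) (a : ℝ) (f : A) :
    S.DW β (algebraMap ℝ A a * f) = algebraMap ℝ A a * S.DW β f := by
  induction β generalizing f with
  | nil => rfl
  | cons i β ih => simp [DW, ih, Derivation.leibniz]

lemma DW_P_sub (β : List (Fin 3)) (m : ℕ) (hβ : β.length = m + 1) :
    S.SqLe (m + 2) (fun f => S.DW β (S.P f) - S.P (S.DW β f)) := by
  have : ∀ f, S.DW β (S.P f) - S.P (S.DW β f) = ∑ i, ∑ j,
      (S.DW β (S.H i j * S.D i (S.D j f)) - S.H i j * S.DW β (S.D i (S.D j f))) := by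
    intro f
    simp only [P, DW_sum, DW_D, Finset.sum_sub_distrib]
  simp only [this]
  refine SqLe.sum _ fun i => SqLe.sum _ fun j => ?_
  obtain ⟨C, hC, h⟩ := S.DW_mul_sub (S.H i j) β
  refine ⟨C, hC, fun f x => (h _ x).trans (mul_le_mul_of_nonneg_left ?_ hC.le)⟩
  rw [hβ]
  exact (S.J_D_le _ _ _ _).trans (S.J_D_le _ _ _ _)

lemma DW_N_sub (β : List (Fin 3)) (m : ℕ) (hβ : β.length = m + 1) :
    S.SqLe (m + 1) (fun f => S.DW β (S.N f) - S.N (S.DW β f)) := by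
  have : ∀ f, S.DW β (S.N f) - S.N (S.DW β f) = ∑ i, ∑ j,
      (S.DW β (S.H i j * S.D i S.r * S.D j f) - S.H i j * S.D i S.r * S.DW β (S.D j f)) := by
    intro f
    simp only [N, DW_sum, DW_D, Finset.sum_sub_distrib]
  simp only [this]
  refine SqLe.sum _ fun i => SqLe.sum _ fun j => ?_
  obtain ⟨C, hC, h⟩ := S.DW_mul_sub (S.H i j * S.D i S.r) β
  refine ⟨C, hC, fun f x => (h _ x).trans (mul_le_mul_of_nonneg_left ?_ hC.le)⟩
  rw [hβ]
  exact S.J_D_le _ _ _ _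

/-- The operator `L b` applied to a high order derivative. -/
lemma L_DW_sq_le {a : ℝ} (ha : 0 < a) (b : ℝ) (β : List (Fin 3)) (m : ℕ)
    (hβ : β.length = m + 1) : ∃ C > 0, ∀ f x, S.ev x (S.L b (S.DW β f) ^ 2) ≤ C * S.ev x
      (S.r ^ 2 * (S.J (m + 1) (S.P f) + S.J (m + 2) f) + S.J (m + 1) (S.L a f)
        + S.J m (S.P f) + S.J (m + 1) f) := by
  obtain ⟨C₁, hC₁, h₁⟩ := S.DW_P_sub β m hβ
  obtain ⟨C₂, hC₂, h₂⟩ := S.DW_N_sub β m hβ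
  obtain ⟨C₃, hC₃, h₃⟩ := S.DW_mul_sub S.r β
  simp only [hβ, Nat.add_sub_cancel] at h₃
  obtain ⟨q, hq⟩ : ∃ q, b = q * a := ⟨b / a, by field_simp⟩
  refine ⟨5 * ((1 - q) ^ 2 + C₁ + q ^ 2 + q ^ 2 * C₃ + b ^ 2 * C₂), by positivity, fun f x => ?_⟩
  have id₀ : algebraMap ℝ A a * S.DW β (S.N f) = S.DW β (S.L a f) - S.DW β (S.r * S.P f) := by
    rw [L, DW_add, DW_algebraMap_mul]; ring
  have id₁ := congrArg (S.ev x) id₀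
  have id₂ : S.ev x (S.L b (S.DW β f)) =
      S.ev x S.r * S.ev x (S.P (S.DW β f)) + b * S.ev x (S.N (S.DW β f)) := by simp [L]
  have k₁ := h₁ f x
  have k₂ := h₂ f x
  have k₃ := h₃ (S.P f) x
  have k₄ := S.DW_sq_le β (S.P f) x
  have k₅ := S.DW_sq_le β (S.L a f) x
  have n₁ := S.J_nonneg (m + 1) (S.P f) x
  have n₂ := S.J_nonneg (m + 2) f x
  have n₃ := S.J_nonneg (m + 1) (S.L a f) x
  have n₄ := S.J_nonneg m (S.P f) x
  have n₅ := S.J_nonneg (m + 1) f x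
  rw [hβ] at k₄ k₅
  simp only [map_sub, map_mul, map_add, map_pow, AlgHom.commutes, Algebra.algebraMap_self,
    RingHom.id_apply] at *
  generalize S.ev x (S.P (S.DW β f)) = p at *
  generalize S.ev x (S.N (S.DW β f)) = n at *
  generalize S.ev x (S.DW β (S.P f)) = P at *
  generalize S.ev x (S.DW β (S.N f)) = N at *
  generalize S.ev x (S.DW β (S.L a f)) = G at *
  generalize S.ev x (S.DW β (S.r * S.P f)) = W at *
  generalize S.ev x S.r = r at *
  generalize S.ev x (S.L b (S.DW β f)) = z at *
  generalize S.ev x (S.J (m + 1) (S.P f)) = J₁ at *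
  generalize S.ev x (S.J (m + 2) f) = J₂ at *
  generalize S.ev x (S.J (m + 1) (S.L a f)) = J₃ at *
  generalize S.ev x (S.J m (S.P f)) = J₄ at *
  generalize S.ev x (S.J (m + 1) f) = J₅ at *
  have id₃ : z = (1 - q) * r * P + -(r * (P - p)) + q * G + -(q * (W - r * P)) + -(b * (N - n)) := by
    rw [id₂]
    linear_combination q * id₁ + N * hq
  have five : ∀ a b c d e : ℝ, (a + b + c + d + e) ^ 2 ≤
      5 * (a ^ 2 + b ^ 2 + c ^ 2 + d ^ 2 + e ^ 2) := by
    intro a b c d e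
    nlinarith [sq_nonneg (a - b), sq_nonneg (a - c), sq_nonneg (a - d), sq_nonneg (a - e),
      sq_nonneg (b - c), sq_nonneg (b - d), sq_nonneg (b - e), sq_nonneg (c - d),
      sq_nonneg (c - e), sq_nonneg (d - e)]
  rw [id₃]
  refine (five _ _ _ _ _).trans ?_
  have t₁ : ((1 - q) * r * P) ^ 2 ≤ (1 - q) ^ 2 * (r ^ 2 * J₁) := by
    rw [mul_pow, mul_pow, mul_assoc]; gcongr
  have t₂ : (-(r * (P - p))) ^ 2 ≤ C₁ * (r ^ 2 * J₂) := by
    rw [neg_sq, mul_pow]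
    have := mul_le_mul_of_nonneg_left k₁ (sq_nonneg r)
    linarith
  have t₃ : (q * G) ^ 2 ≤ q ^ 2 * J₃ := by rw [mul_pow]; gcongr
  have t₄ : (-(q * (W - r * P))) ^ 2 ≤ q ^ 2 * C₃ * J₄ := by
    rw [neg_sq, mul_pow, mul_assoc]; gcongr
  have t₅ : (-(b * (N - n))) ^ 2 ≤ b ^ 2 * C₂ * J₅ := by
    rw [neg_sq, mul_pow, mul_assoc]; gcongr
  have hsum : ∀ c₁ c₂ c₃ c₄ c₅ x₁ x₂ x₃ x₄ x₅ : ℝ, 0 ≤ c₁ → 0 ≤ c₂ → 0 ≤ c₃ → 0 ≤ c₄ → 0 ≤ c₅ →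
      0 ≤ x₁ → 0 ≤ x₂ → 0 ≤ x₃ → 0 ≤ x₄ → 0 ≤ x₅ →
      c₁ * x₁ + c₂ * x₂ + c₃ * x₃ + c₄ * x₄ + c₅ * x₅ ≤
        (c₁ + c₂ + c₃ + c₄ + c₅) * (x₁ + x₂ + x₃ + x₄ + x₅) := by
    intro c₁ c₂ c₃ c₄ c₅ x₁ x₂ x₃ x₄ x₅ _ _ _ _ _ _ _ _ _ _
    have s₁ : c₁ * x₁ ≤ c₁ * (x₁ + x₂ + x₃ + x₄ + x₅) := by gcongr; linarith
    have s₂ : c₂ * x₂ ≤ c₂ * (x₁ + x₂ + x₃ + x₄ + x₅) := by gcongr; linarith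
    have s₃ : c₃ * x₃ ≤ c₃ * (x₁ + x₂ + x₃ + x₄ + x₅) := by gcongr; linarith
    have s₄ : c₄ * x₄ ≤ c₄ * (x₁ + x₂ + x₃ + x₄ + x₅) := by gcongr; linarith
    have s₅ : c₅ * x₅ ≤ c₅ * (x₁ + x₂ + x₃ + x₄ + x₅) := by gcongr; linarith
    linarith
  have := hsum ((1 - q) ^ 2) C₁ (q ^ 2) (q ^ 2 * C₃) (b ^ 2 * C₂) (r ^ 2 * J₁) (r ^ 2 * J₂) J₃ J₄ J₅
    (by positivity) hC₁.le (by positivity) (by positivity) (by positivity) (by positivity)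
    (by positivity) n₃ n₄ n₅
  rw [mul_add (r ^ 2)]
  linarith

/-- The second order estimate for derivatives along words of a fixed length. -/
lemma words_estimate {a b : ℝ} (ha : 0 < a) (hb : 0 < b) (m : ℕ) :
    ∃ C > 0, ∀ β : List (Fin 3), β.length = m + 1 → ∀ f,
      S.I (b + 1) (S.J 2 (S.DW β f)) ≤ C * (S.I (b + 1) (S.J (m + 1) (S.P f))
        + S.I (b + 1) (S.J (m + 2) f) + S.I (b - 1) (S.J (m + 1) (S.L a f))
        + S.I (b - 1) (S.J m (S.P f)) + S.I (b - 1) (S.J (m + 1) f)) := by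
  have hs : -1 < b - 1 := by linarith
  have eb : b - 1 + 2 = b + 1 := by ring
  obtain ⟨C₀, hC₀, h₀⟩ := S.base_estimate_J hb
  choose C hC h using fun β : List.Vector (Fin 3) (m + 1) => S.L_DW_sq_le ha b β.1 m β.2
  have hC' := Finset.sum_nonneg fun β (_ : β ∈ Finset.univ) => (hC β).le
  refine ⟨C₀ * (∑ β, C β + 1), by positivity, fun β hβ f => ?_⟩
  have e₁ := S.I_le_mul hs _ (h ⟨β, hβ⟩ f)
  rw [S.I_add hs, S.I_add hs, S.I_add hs, I_rr_mul, eb, S.I_add (by linarith)] at e₁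
  have e₂ : S.I (b - 1) (S.DW β f ^ 2) ≤ S.I (b - 1) (S.J (m + 1) f) :=
    S.I_mono hs fun x => by rw [map_pow, ← hβ]; exact S.DW_sq_le β f x
  have e₃ := Finset.single_le_sum (f := C) (fun β _ => (hC β).le) (Finset.mem_univ ⟨β, hβ⟩)
  have n₁ := S.I_J_nonneg (b + 1) (m + 1) (S.P f)
  have n₂ := S.I_J_nonneg (b + 1) (m + 2) f
  have n₃ := S.I_J_nonneg (b - 1) (m + 1) (S.L a f)
  have n₄ := S.I_J_nonneg (b - 1) m (S.P f)
  have n₅ := S.I_J_nonneg (b - 1) (m + 1) f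
  rw [mul_assoc]
  refine (h₀ _).trans (mul_le_mul_of_nonneg_left ?_ hC₀.le)
  rw [add_mul, one_mul]
  refine add_le_add (e₁.trans (mul_le_mul_of_nonneg_right e₃ (by positivity))) (e₂.trans ?_)
  linarith

/-- The higher order elliptic estimate. -/
theorem elliptic_estimate (n : ℕ) : ∀ {a : ℝ}, 0 < a → ∃ C > 0, ∀ f,
    S.I (a + 2 * n + 1) (S.J (2 * n + 2) f) ≤
      C * (S.I (a + 2 * n - 1) (S.J (2 * n) (S.L a f)) + S.I (a - 1) (f ^ 2)) := by
  induction n with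
  | zero => intro a ha; simpa [J] using S.base_estimate_J ha
  | succ n ih =>
    intro a ha
    have hn : (0 : ℝ) ≤ n := n.cast_nonneg
    set s : ℝ := a + 2 * n + 1 with hs_def
    have hs : -1 < s := by linarith
    have hs2 : -1 < s + 2 := by linarith
    have ex : a + 2 * ((n + 1 : ℕ) : ℝ) + 1 = s + 2 := by push_cast; ring
    have ex' : a + 2 * ((n + 1 : ℕ) : ℝ) - 1 = s := by push_cast; ring
    rw [ex, ex']
    obtain ⟨C₁, hC₁, h₁⟩ := ih ha
    obtain ⟨C₂, hC₂, h₂⟩ := S.hardy_J (s := a + 2 * n - 1) (by linarith) (2 * n)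
    rw [show a + 2 * n - 1 + 2 = s by ring] at h₂
    obtain ⟨C₃, hC₃, h₃⟩ := S.base_estimate_J ha
    obtain ⟨C₄, hC₄, h₄⟩ := S.hardy_iterate (s := a - 1) (by linarith) 0 (n + 1)
    rw [show a - 1 + 2 * ((n + 1 : ℕ) : ℝ) = s by push_cast; ring] at h₄
    obtain ⟨C₅, hC₅, h₅⟩ := ih (a := a + 2) (by linarith)
    rw [show a + 2 + 2 * n + 1 = s + 2 by ring, show a + 2 + 2 * n - 1 = s by ring,
      show a + 2 - 1 = a + 1 by ring] at h₅
    obtain ⟨C₆, hC₆, h₆⟩ := S.isOp_P (2 * n)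
    have hQ : S.IsOp 2 (fun f => -(S.P S.r * S.P f
        + algebraMap ℝ A a * (S.P (S.N f) - S.N (S.P f)))) := by
      have e₁ := ((S.isOp_mul (S.P S.r)).comp S.isOp_P).add
        ((S.isOp_mul (algebraMap ℝ A a)).comp S.isOp_comm)
      have e₂ := (S.isOp_mul (-1)).comp e₁
      simpa only [zero_add, neg_one_mul] using e₂
    obtain ⟨C₇, hC₇, h₇⟩ := hQ (2 * n)
    beta_reduce at h₇
    obtain ⟨C₈, hC₈, h₈⟩ := S.isOp_P 0
    obtain ⟨C₉, hC₉, h₉⟩ := S.hardy_J hs (2 * n + 1)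
    obtain ⟨C₁₀, hC₁₀, h₁₀⟩ := S.words_estimate (b := s + 1) ha (by linarith) (2 * n + 1)
    obtain ⟨C₁₁, hC₁₁, h₁₁⟩ := S.J_le_of_words hs2 (2 * n + 2)
    obtain ⟨C₁₂, hC₁₂, h₁₂⟩ := S.I_add_two_le hs
    obtain ⟨C₁₃, hC₁₃, h₁₃⟩ := S.interpolation_J (b := s + 1) (ε := 1 / (2 * (C₁₁ * C₁₀)))
      (by linarith) (by positivity) (2 * n + 2)
    rw [add_sub_cancel_right, show s + 1 + 1 = s + 2 by ring] at h₁₀ h₁₃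
    set c₁ := C₁ * (C₂ + 1) with hc₁
    set c₂ := C₃ * (C₄ + 1) with hc₂
    set c₃ := C₅ * (2 * (C₆ + C₇ * c₁) + C₈ * c₂) with hc₃
    set c₄ := C₁₀ * (c₃ + 1 + C₉ * c₃ + c₁) + C₁₂ * c₁ with hc₄
    refine ⟨2 * (C₁₁ * c₄ + C₁₁ * C₁₀ * C₁₃ * c₁), by positivity, fun f => ?_⟩
    rw [show 2 * (n + 1) + 2 = 2 * n + 2 + 2 from rfl, show 2 * (n + 1) = 2 * n + 2 from rfl]
    set T := S.I s (S.J (2 * n + 2) (S.L a f)) + S.I (a - 1) (f ^ 2) with hT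
    have hG : 0 ≤ S.I s (S.J (2 * n + 2) (S.L a f)) := S.I_J_nonneg _ _ _
    have hF : 0 ≤ S.I (a - 1) (f ^ 2) := S.I_nonneg fun x => by rw [map_pow]; positivity
    have hT0 : 0 ≤ T := by positivity
    have hGT : S.I s (S.J (2 * n + 2) (S.L a f)) ≤ T := by linarith
    have hFT : S.I (a - 1) (f ^ 2) ≤ T := by linarith
    have k₁ : S.I s (S.J (2 * n + 2) f) ≤ c₁ * T := by
      have e := ((h₂ (S.L a f)).trans (mul_le_mul_of_nonneg_left
        ((S.I_J_mono hs (by omega : 2 * n + 1 ≤ 2 * n + 2) _).trans hGT) hC₂.le))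
      refine (h₁ f).trans ?_
      rw [hc₁, mul_assoc]
      exact mul_le_mul_of_nonneg_left (by linarith) hC₁.le
    have k₂ : S.I (a + 1) (S.J 2 f) ≤ c₂ * T := by
      have e := ((h₄ (S.L a f)).trans (mul_le_mul_of_nonneg_left
        ((S.I_J_mono hs (by omega : 0 + (n + 1) ≤ 2 * n + 2) _).trans hGT) hC₄.le))
      refine (h₃ f).trans ?_
      rw [hc₂, mul_assoc]
      exact mul_le_mul_of_nonneg_left (by simp only [J] at e; linarith) hC₃.le
    have k₃ : S.I (s + 2) (S.J (2 * n + 2) (S.P f)) ≤ c₃ * T := by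
      refine (h₅ _).trans ?_
      rw [hc₃, mul_assoc]
      refine mul_le_mul_of_nonneg_left ?_ hC₅.le
      have e₁ : S.I s (S.J (2 * n) (S.L (a + 2) (S.P f))) ≤
          2 * (S.I s (S.J (2 * n) (S.P (S.L a f))) + S.I s (S.J (2 * n) (-(S.P S.r * S.P f
            + algebraMap ℝ A a * (S.P (S.N f) - S.N (S.P f)))))) := by
        rw [L_P, ← S.I_add hs]
        exact S.I_le_mul hs _ fun x => by rw [map_add]; exact S.J_add_le _ _ _ _
      have e₂ := S.I_le_mul hs _ (h₆ (S.L a f))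
      have e₃ := S.I_le_mul hs _ (h₇ f)
      have e₄ := S.I_le_mul (by linarith : -1 < a + 1) _ (h₈ f)
      rw [zero_add, J] at e₄
      have e₅ := mul_le_mul_of_nonneg_left hGT hC₆.le
      have e₆ := mul_le_mul_of_nonneg_left k₁ hC₇.le
      have e₇ := mul_le_mul_of_nonneg_left k₂ hC₈.le
      linarith
    have k₄ : S.I s (S.J (2 * n + 1) (S.P f)) ≤ C₉ * c₃ * T := by
      rw [mul_assoc]
      exact (h₉ _).trans (mul_le_mul_of_nonneg_left k₃ hC₉.le)
    have k₅ := h₁₁ f (c₄ * T + C₁₀ * S.I (s + 2) (S.J (2 * n + 3) f)) (fun β hβ => by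
      refine (h₁₀ β hβ f).trans ?_
      have e : 0 ≤ C₁₂ * c₁ * T := by positivity
      have e' : S.I (s + 2) (S.J (2 * n + 1 + 1) (S.P f))
          + S.I (s + 2) (S.J (2 * n + 1 + 2) f) + S.I s (S.J (2 * n + 1 + 1) (S.L a f))
          + S.I s (S.J (2 * n + 1) (S.P f)) + S.I s (S.J (2 * n + 1 + 1) f) ≤
          (c₃ + 1 + C₉ * c₃ + c₁) * T + S.I (s + 2) (S.J (2 * n + 3) f) := by linarith
      have := mul_le_mul_of_nonneg_left e' hC₁₀.le
      rw [hc₄]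
      linarith) (by
      have e := (h₁₂ _ (S.J_nonneg (2 * n + 2) f)).trans (mul_le_mul_of_nonneg_left k₁ hC₁₂.le)
      have e₁ : 0 ≤ C₁₀ * (c₃ + 1 + C₉ * c₃ + c₁) * T := by positivity
      have e₂ := mul_nonneg hC₁₀.le (S.I_J_nonneg (s + 2) (2 * n + 3) f)
      rw [hc₄]
      linarith)
    have k₆ := mul_le_mul_of_nonneg_left (h₁₃ f) (by positivity : 0 ≤ C₁₁ * C₁₀)
    have k₇ : C₁₁ * C₁₀ * (1 / (2 * (C₁₁ * C₁₀)) * S.I (s + 2) (S.J (2 * n + 2 + 2) f)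
        + C₁₃ * S.I s (S.J (2 * n + 2) f)) = S.I (s + 2) (S.J (2 * n + 2 + 2) f) / 2
        + C₁₁ * C₁₀ * C₁₃ * S.I s (S.J (2 * n + 2) f) := by
      field_simp
    have k₈ := mul_le_mul_of_nonneg_left k₁ (by positivity : 0 ≤ C₁₁ * C₁₀ * C₁₃)
    rw [k₇] at k₆
    linarith

end WeightedCalculus

open Filter Topology in
/-- Power functions can be truncated near the origin with uniform bounds. -/
lemma exists_truncated_rpow {s : ℝ} (hs : -1 < s) : ∃ M > 0, ∀ ε > 0, ∃ φ : ℝ → ℝ,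
    ContDiff ℝ 1 φ ∧ (∃ δ > 0, ∀ t ≤ δ, φ t = 0) ∧ (∀ t > 0, 0 ≤ φ t ∧ φ t ≤ t ^ (s + 1)) ∧
    (∀ t > 0, 0 ≤ deriv φ t ∧ deriv φ t ≤ M * t ^ s) ∧
    ∀ t > 2 * ε, φ t = t ^ (s + 1) ∧ deriv φ t = (s + 1) * t ^ s := by
  set χ := Real.smoothTransition
  have hχ : ContDiff ℝ 1 χ := Real.smoothTransition.contDiff
  have hχd : Differentiable ℝ χ := hχ.differentiable one_ne_zero
  have hχ0 : ∀ y, 0 ≤ deriv χ y := fun y => Real.smoothTransition.monotone.deriv_nonneg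
  have hχ1 : ∀ y > 1, deriv χ y = 0 := by
    intro y hy
    have : χ =ᶠ[𝓝 y] fun _ => 1 := by
      filter_upwards [eventually_gt_nhds hy] with z hz
      exact Real.smoothTransition.one_of_one_le hz.le
    rw [this.deriv_eq, deriv_const]
  obtain ⟨K, hK⟩ := isCompact_Icc.exists_bound_of_continuousOn (s := Icc (0 : ℝ) 1)
    (hχ.continuous_deriv le_rfl).continuousOn
  have hK0 : 0 ≤ K := (norm_nonneg _).trans (hK 0 (by simp))
  refine ⟨(s + 1) + 2 * K, by linarith, fun ε hε => ?_⟩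
  set φ : ℝ → ℝ := fun t => t ^ (s + 1) * χ (t / ε - 1) with hφ
  have hφ0 : ∀ t ≤ ε, φ t = 0 := by
    intro t ht
    have : t / ε - 1 ≤ 0 := by rw [sub_nonpos, div_le_one hε]; exact ht
    simp only [hφ, χ, Real.smoothTransition.zero_of_nonpos this, mul_zero]
  have hd : ∀ t > 0, HasDerivAt φ ((s + 1) * t ^ s * χ (t / ε - 1)
      + t ^ (s + 1) * (deriv χ (t / ε - 1) * (1 / ε))) t := by
    intro t ht
    have h1 := Real.hasDerivAt_rpow_const (x := t) (p := s + 1) (Or.inl ht.ne')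
    rw [add_sub_cancel_right] at h1
    have h2 : HasDerivAt (fun t : ℝ => t / ε - 1) (1 / ε) t :=
      ((hasDerivAt_id t).div_const ε).sub_const 1
    exact h1.mul ((hχd _).hasDerivAt.comp t h2)
  have hφ1 : ∀ t > 2 * ε, φ t = t ^ (s + 1) := by
    intro t ht
    have : 1 ≤ t / ε - 1 := by rw [le_sub_iff_add_le, le_div_iff₀ hε]; linarith
    simp only [hφ, χ, Real.smoothTransition.one_of_one_le this, mul_one]
  refine ⟨φ, ?_, ⟨ε, hε, hφ0⟩, fun t ht => ⟨?_, ?_⟩, fun t ht => ?_, fun t ht => ⟨hφ1 t ht, ?_⟩⟩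
  · rw [contDiff_iff_contDiffAt]
    intro t
    rcases lt_or_ge 0 t with ht | ht
    · exact (Real.contDiffAt_rpow_const_of_ne ht.ne').mul
        (hχ.contDiffAt.comp t ((contDiffAt_id.div_const ε).sub contDiffAt_const))
    · have : φ =ᶠ[𝓝 t] fun _ => 0 := by
        filter_upwards [eventually_lt_nhds (ht.trans_lt hε)] with z hz using hφ0 z hz.le
      exact contDiffAt_const.congr_of_eventuallyEq this
  · exact mul_nonneg (Real.rpow_nonneg ht.le _) (Real.smoothTransition.nonneg _)
  · exact mul_le_of_le_one_right (Real.rpow_nonneg ht.le _) (Real.smoothTransition.le_one _)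
  · rw [(hd t ht).deriv]
    have p₀ := Real.rpow_nonneg ht.le s
    have p₁ := Real.rpow_nonneg ht.le (s + 1)
    have p₂ : 0 ≤ χ (t / ε - 1) := Real.smoothTransition.nonneg _
    have p₃ : χ (t / ε - 1) ≤ 1 := Real.smoothTransition.le_one _
    have p₄ := hχ0 (t / ε - 1)
    have p₅ : 0 ≤ s + 1 := by linarith
    refine ⟨by positivity, ?_⟩
    have e₁ : (s + 1) * t ^ s * χ (t / ε - 1) ≤ (s + 1) * t ^ s :=
      mul_le_of_le_one_right (by positivity) p₃
    have e₂ : t ^ (s + 1) * (deriv χ (t / ε - 1) * (1 / ε)) ≤ 2 * K * t ^ s := by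
      rw [Real.rpow_add_one ht.ne']
      rcases lt_or_ge 1 (t / ε - 1) with h | h
      · rw [hχ1 _ h]; simp; positivity
      rcases lt_or_ge (t / ε - 1) 0 with h' | h'
      · have : χ =ᶠ[𝓝 (t / ε - 1)] fun _ => 0 := by
          filter_upwards [eventually_lt_nhds h'] with z hz
          exact Real.smoothTransition.zero_of_nonpos hz.le
        rw [this.deriv_eq, deriv_const]; simp; positivity
      · have k := (le_abs_self _).trans (hK _ ⟨h', h⟩)
        have k' : t / ε ≤ 2 := by linarith
        have : t ^ s * t * (deriv χ (t / ε - 1) * (1 / ε)) =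
            t ^ s * ((t / ε) * deriv χ (t / ε - 1)) := by ring
        rw [this]
        have := mul_le_mul k' k p₄ zero_le_two
        nlinarith
    linarith
  · have : φ =ᶠ[𝓝 t] fun t => t ^ (s + 1) := by
      filter_upwards [eventually_gt_nhds ht] with z hz using hφ1 z hz
    rw [this.deriv_eq, Real.deriv_rpow_const, add_sub_cancel_right]

section
variable {X : Type*} [MeasurableSpace X] {μ : Measure X} {ρ : X → ℝ}

open Filter Topology in
/-- A power of `ρ` of exponent `> -1` is integrable as soon as `ρ` has a controlled weighted
Dirichlet integral. -/
lemma integrable_rpow_of_truncated [IsFiniteMeasure μ] {s : ℝ} (hs : -1 < s) (hρm : Measurable ρ)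
    (hρ : ∀ x, 0 < ρ x) {R : ℝ} (hR : ∀ x, ρ x ≤ R) {p q : X → ℝ}
    (hp : AEStronglyMeasurable p μ) (hq : AEStronglyMeasurable q μ)
    {B : ℝ} (hpB : ∀ x, |p x| ≤ B) (hqB : ∀ x, |q x| ≤ B) (hp0 : ∀ x, 0 ≤ p x) {c : ℝ}
    (hc : 0 < c) (hcp : ∀ x, c ≤ p x + ρ x)
    (h : ∀ φ : ℝ → ℝ, ContDiff ℝ 1 φ → (∃ δ > 0, ∀ t ≤ δ, φ t = 0) →
      ∫ x, deriv φ (ρ x) * p x + φ (ρ x) * q x ∂μ = 0) :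
    Integrable (fun x => ρ x ^ s) μ := by
  obtain ⟨M, hM, hφ⟩ := exists_truncated_rpow hs
  set ε : ℕ → ℝ := fun n => 1 / ((n : ℝ) + 1) with hε
  have hε0 : ∀ n, 0 < ε n := fun n => Nat.one_div_pos_of_nat
  set U : ℕ → Set X := fun n => {x | 2 * ε n < ρ x} with hU
  have hUm : ∀ n, MeasurableSet (U n) := fun n => measurableSet_lt measurable_const hρm
  have hcov : AECover μ atTop U := by
    refine ⟨ae_of_all _ fun x => ?_, hUm⟩
    have : Tendsto (fun n => 2 * ε n) atTop (𝓝 (2 * 0)) :=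
      tendsto_one_div_add_atTop_nhds_zero_nat.const_mul 2
    rw [mul_zero] at this
    exact this.eventually_lt_const (hρ x)
  have hsm : Measurable fun x => ρ x ^ s := hρm.pow_const s
  have hρU : ∀ n, IntegrableOn (fun x => ρ x ^ s) (U n) μ := by
    intro n
    refine Measure.integrableOn_of_bounded (M := (2 * ε n) ^ s + R ^ s) (measure_ne_top _ _)
      hsm.aestronglyMeasurable ?_
    filter_upwards [ae_restrict_mem (hUm n)] with x hx
    have hx' : 2 * ε n < ρ x := hx
    have h2 : 0 < 2 * ε n := by have := hε0 n; positivity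
    have hR0 : 0 < R := (hρ x).trans_le (hR x)
    rw [Real.norm_of_nonneg (Real.rpow_nonneg (hρ x).le _)]
    rcases le_total 0 s with h0 | h0
    · have := Real.rpow_le_rpow (hρ x).le (hR x) h0
      have := Real.rpow_nonneg h2.le s
      linarith
    · have := Real.rpow_le_rpow_of_nonpos h2 hx'.le h0
      have := Real.rpow_nonneg hR0.le s
      linarith
  have hRs : ∀ x, ρ x ^ (s + 1) ≤ R ^ (s + 1) := fun x =>
    Real.rpow_le_rpow (hρ x).le (hR x) (by linarith)
  refine hcov.integrable_of_integral_norm_bounded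
    ((1 / c) * ((R ^ (s + 1) * B / (s + 1) + R ^ (s + 1)) * μ.real univ)) hρU
    (Eventually.of_forall fun n => ?_)
  obtain ⟨φ, hφC, hφδ, hφ0, hφd, hφe⟩ := hφ (ε n) (hε0 n)
  have hB0 : ∀ x : X, 0 ≤ B := fun x => (abs_nonneg _).trans (hpB x)
  have m₁ : Measurable fun x => deriv φ (ρ x) := (hφC.continuous_deriv le_rfl).measurable.comp hρm
  have m₂ : Measurable fun x => φ (ρ x) := hφC.continuous.measurable.comp hρm
  have i₂ : Integrable (fun x => φ (ρ x) * q x) μ := by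
    refine Integrable.of_bound (m₂.aestronglyMeasurable.mul hq) (R ^ (s + 1) * B)
      (ae_of_all _ fun x => ?_)
    rw [norm_mul, Real.norm_eq_abs, Real.norm_eq_abs]
    have := hφ0 _ (hρ x)
    rw [abs_of_nonneg this.1]
    exact mul_le_mul (this.2.trans (hRs x)) (hqB x) (abs_nonneg _)
      (Real.rpow_nonneg ((hρ x).le.trans (hR x)) _)
  obtain ⟨δ, hδ, hφδ⟩ := hφδ
  obtain ⟨K, hK⟩ := isCompact_Icc.exists_bound_of_continuousOn (s := Icc (0 : ℝ) R)
    (hφC.continuous_deriv le_rfl).continuousOn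
  have i₁ : Integrable (fun x => deriv φ (ρ x) * p x) μ := by
    refine Integrable.of_bound (m₁.aestronglyMeasurable.mul hp) (K * B) (ae_of_all _ fun x => ?_)
    rw [norm_mul]
    have hk := hK _ ⟨(hρ x).le, hR x⟩
    exact mul_le_mul hk (hpB x) (norm_nonneg _) ((norm_nonneg _).trans hk)
  have key := h φ hφC ⟨δ, hδ, hφδ⟩
  rw [integral_add i₁ i₂] at key
  have b₂ : |∫ x, φ (ρ x) * q x ∂μ| ≤ R ^ (s + 1) * B * μ.real univ := by
    rw [← Real.norm_eq_abs]
    refine norm_integral_le_of_norm_le_const (ae_of_all _ fun x => ?_)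
    rw [norm_mul, Real.norm_eq_abs, Real.norm_eq_abs]
    have := hφ0 _ (hρ x)
    rw [abs_of_nonneg this.1]
    exact mul_le_mul (this.2.trans (hRs x)) (hqB x) (abs_nonneg _)
      (Real.rpow_nonneg ((hρ x).le.trans (hR x)) _)
  have b₁ : ∫ x, deriv φ (ρ x) * p x ∂μ ≤ R ^ (s + 1) * B * μ.real univ := by
    have := neg_abs_le (∫ x, φ (ρ x) * q x ∂μ)
    linarith
  have s1 : 0 < s + 1 := by linarith
  have pw : ∀ x ∈ U n, ‖ρ x ^ s‖ ≤
      (1 / c) * (deriv φ (ρ x) * p x / (s + 1) + R ^ (s + 1)) := by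
    intro x hx
    have p₀ := Real.rpow_nonneg (hρ x).le s
    rw [Real.norm_of_nonneg p₀, (hφe _ hx).2]
    have e := hRs x
    rw [Real.rpow_add_one (hρ x).ne'] at e
    have e' := mul_le_mul_of_nonneg_left (hcp x) p₀
    rw [one_div, le_inv_mul_iff₀ hc]
    have : (s + 1) * ρ x ^ s * p x / (s + 1) = ρ x ^ s * p x := by field_simp
    rw [this]
    linarith
  have i₃ : Integrable (fun x => (1 / c) * (deriv φ (ρ x) * p x / (s + 1) + R ^ (s + 1))) μ :=
    ((i₁.div_const _).add (integrable_const _)).const_mul _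
  calc ∫ x in U n, ‖ρ x ^ s‖ ∂μ
      ≤ ∫ x in U n, (1 / c) * (deriv φ (ρ x) * p x / (s + 1) + R ^ (s + 1)) ∂μ :=
        setIntegral_mono_on (hρU n).norm i₃.integrableOn (hUm n) pw
    _ ≤ ∫ x, (1 / c) * (deriv φ (ρ x) * p x / (s + 1) + R ^ (s + 1)) ∂μ := by
        refine setIntegral_le_integral i₃ (ae_of_all _ fun x => ?_)
        have := mul_nonneg (hφd _ (hρ x)).1 (hp0 x)
        have := Real.rpow_nonneg ((hρ x).le.trans (hR x)) (s + 1)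
        positivity
    _ = (1 / c) * ((∫ x, deriv φ (ρ x) * p x ∂μ) / (s + 1) + R ^ (s + 1) * μ.real univ) := by
        rw [integral_const_mul, integral_add (i₁.div_const _) (integrable_const _),
          integral_div, integral_const, smul_eq_mul, mul_comm (μ.real univ)]
    _ ≤ _ := by
        rw [add_mul, div_mul_eq_mul_div (R ^ (s + 1) * B)]
        exact mul_le_mul_of_nonneg_left (add_le_add_left (div_le_div_of_nonneg_right b₁ s1.le) _)
          (one_div_nonneg.2 hc.le)

open Filter Topology in
/-- The weighted divergence identity follows from its truncated versions. -/
lemma integral_rpow_mul_eq_zero_of_truncated {s : ℝ} (hs : -1 < s) (hρm : Measurable ρ)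
    (hρ : ∀ x, 0 < ρ x) (hρs : Integrable (fun x => ρ x ^ s) μ) {R : ℝ} (hR : ∀ x, ρ x ≤ R)
    {p q : X → ℝ} (hp : AEStronglyMeasurable p μ) (hq : AEStronglyMeasurable q μ)
    {B : ℝ} (hpB : ∀ x, |p x| ≤ B) (hqB : ∀ x, |q x| ≤ B)
    (h : ∀ φ : ℝ → ℝ, ContDiff ℝ 1 φ → (∃ δ > 0, ∀ t ≤ δ, φ t = 0) →
      ∫ x, deriv φ (ρ x) * p x + φ (ρ x) * q x ∂μ = 0) :
    ∫ x, ρ x ^ s * (ρ x * q x + (s + 1) * p x) ∂μ = 0 := by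
  obtain ⟨M, hM, hφ⟩ := exists_truncated_rpow hs
  set ε : ℕ → ℝ := fun n => 1 / ((n : ℝ) + 1) with hε
  have hε0 : ∀ n, 0 < ε n := fun n => Nat.one_div_pos_of_nat
  choose φ hφC hφδ hφ0 hφd hφe using fun n => hφ (ε n) (hε0 n)
  have lim : Tendsto (fun n => ∫ x, deriv (φ n) (ρ x) * p x + φ n (ρ x) * q x ∂μ) atTop
      (𝓝 (∫ x, ρ x ^ s * (ρ x * q x + (s + 1) * p x) ∂μ)) := by
    refine tendsto_integral_of_dominated_convergence
      (fun x => ρ x ^ s * (M * B + R * B)) (fun n => ?_) (hρs.mul_const _)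
      (fun n => ae_of_all _ fun x => ?_) (ae_of_all _ fun x => ?_)
    · exact (((hφC n).continuous_deriv le_rfl).measurable.comp
        hρm).aestronglyMeasurable.mul hp |>.add
          (((hφC n).continuous.measurable.comp hρm).aestronglyMeasurable.mul hq)
    · have p₀ := Real.rpow_nonneg (hρ x).le s
      have d := hφd n _ (hρ x)
      have e := hφ0 n _ (hρ x)
      rw [Real.rpow_add_one (hρ x).ne'] at e
      refine (norm_add_le _ _).trans ?_
      rw [norm_mul, norm_mul, Real.norm_of_nonneg d.1, Real.norm_of_nonneg e.1]
      have t₁ : deriv (φ n) (ρ x) * ‖p x‖ ≤ M * ρ x ^ s * B :=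
        mul_le_mul d.2 (hpB x) (norm_nonneg _) (by positivity)
      have t₂ : φ n (ρ x) * ‖q x‖ ≤ ρ x ^ s * R * B :=
        mul_le_mul (e.2.trans (mul_le_mul_of_nonneg_left (hR x) p₀)) (hqB x) (norm_nonneg _)
          (mul_nonneg p₀ ((hρ x).le.trans (hR x)))
      linarith
    · refine tendsto_const_nhds.congr' ?_
      have : Tendsto (fun n => 2 * ε n) atTop (𝓝 (2 * 0)) :=
        tendsto_one_div_add_atTop_nhds_zero_nat.const_mul 2
      rw [mul_zero] at this
      filter_upwards [this.eventually_lt_const (hρ x)] with n hn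
      rw [(hφe n _ hn).1, (hφe n _ hn).2, Real.rpow_add_one (hρ x).ne']
      ring
  refine tendsto_nhds_unique lim ?_
  simp only [fun n => h (φ n) (hφC n) (hφδ n)]
  exact tendsto_const_nhds

end

open Filter Topology in
/-- The closure of a domain with smooth boundary has unique derivatives. -/
lemma HasSmoothBoundary.uniqueDiffOn_closure {n : ℕ} {Ω : Set (Fin n → ℝ)}
    (h : HasSmoothBoundary Ω) (hΩ : IsOpen Ω) : UniqueDiffOn ℝ (closure Ω) := by
  obtain ⟨ρ, hρ, rfl, hb⟩ := h
  intro x hx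
  by_cases hx' : 0 < ρ x
  · exact (hΩ.uniqueDiffWithinAt hx').mono subset_closure
  obtain ⟨h0, hd⟩ := hb x ⟨hx, by rwa [hΩ.interior_eq]⟩
  refine UniqueDiffWithinAt.mono (s := {x | 0 < ρ x}) ⟨?_, hx⟩ subset_closure
  have hcone : {v | 0 < fderiv ℝ ρ x v} ⊆ tangentConeAt ℝ {x | 0 < ρ x} x := by
    intro v hv
    refine mem_tangentConeAt_of_add_smul_mem (l := 𝓝[>] (0 : ℝ)) (c := id)
      (tendsto_id.mono_right (nhdsWithin_mono _ fun t (ht : 0 < t) => ht.ne')) ?_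
    have hl : HasDerivAt (fun t : ℝ => ρ (x + t • v)) (fderiv ℝ ρ x v) 0 := by
      have h1 : HasFDerivAt ρ (fderiv ℝ ρ x) x :=
        ((hρ.differentiable (by simp)) x).hasFDerivAt
      exact h1.hasLineDerivAt v
    have hl' := (hasDerivAt_iff_tendsto_slope.1 hl).mono_left
      (nhdsWithin_mono 0 (fun t (ht : 0 < t) => ht.ne') : 𝓝[>] (0 : ℝ) ≤ 𝓝[≠] 0)
    filter_upwards [hl'.eventually (eventually_gt_nhds hv), self_mem_nhdsWithin] with t ht ht0
    simp only [slope_def_field, zero_smul, add_zero, h0, sub_zero] at ht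
    have ht0' : 0 < t := ht0
    exact (div_pos_iff_of_pos_right ht0').1 ht
  obtain ⟨v, hv⟩ : ∃ v, 0 < fderiv ℝ ρ x v := by
    by_contra! hcon
    refine hd (ContinuousLinearMap.ext fun v => le_antisymm (hcon v) ?_)
    simpa using hcon (-v)
  have hopen : IsOpen {v | 0 < fderiv ℝ ρ x v} :=
    isOpen_lt continuous_const (fderiv ℝ ρ x).continuous
  have htop : Submodule.span ℝ (tangentConeAt ℝ {x | 0 < ρ x} x) = ⊤ :=
    Submodule.eq_top_of_nonempty_interior' _ ⟨v, mem_interior.2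
      ⟨_, hcone.trans Submodule.subset_span, hopen, hv⟩⟩
  rw [htop]
  exact dense_univ

lemma pd_congr_of_eqOn {n : ℕ} {Ω : Set (Fin n → ℝ)} (hΩ : IsOpen Ω) {f g : (Fin n → ℝ) → ℝ}
    (h : EqOn f g Ω) (i : Fin n) : EqOn (pd i f) (pd i g) Ω := fun x hx => by
  rw [pd, pd, (h.eventuallyEq_of_mem (hΩ.mem_nhds hx)).fderiv_eq]

open Filter Topology in
/-- The divergence theorem for functions cut off near the boundary by a defining function. -/
lemma setIntegral_truncated_eq_zero {n : ℕ} {Ω : Set (Fin n → ℝ)} (hΩ : IsOpen Ω)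
    (hΩb : Bornology.IsBounded Ω) {r f : (Fin n → ℝ) → ℝ} (hrc : ContinuousOn r (closure Ω))
    (hr : ContDiffOn ℝ 1 r Ω) (hr0 : ∀ x ∈ frontier Ω, r x = 0) (hf : ContDiffOn ℝ 1 f Ω)
    (i : Fin n) {φ : ℝ → ℝ} (hφ : ContDiff ℝ 1 φ) (hφ0 : ∃ δ > 0, ∀ t ≤ δ, φ t = 0) :
    ∫ x in Ω, deriv φ (r x) * (pd i r x * f x) + φ (r x) * pd i f x = 0 := by
  classical
  obtain ⟨δ, hδ, hφ0⟩ := hφ0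
  set h : (Fin n → ℝ) → ℝ := Ω.indicator fun x => φ (r x) * f x with hh
  set K := closure Ω ∩ {x | δ ≤ r x} with hK
  have hcl : IsCompact (closure Ω) := hΩb.isCompact_closure
  have hKc : IsCompact K := by
    refine hcl.of_isClosed_subset ?_ inter_subset_left
    exact hrc.preimage_isClosed_of_isClosed isClosed_closure isClosed_Ici
  have hKΩ : K ⊆ Ω := by
    intro x hx
    by_contra hx'
    have := hr0 x ⟨hx.1, by rwa [hΩ.interior_eq]⟩
    have h2 : δ ≤ r x := hx.2
    linarith
  have hout : ∀ x ∉ K, h x = 0 := by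
    intro x hx
    by_cases hxΩ : x ∈ Ω
    · have : r x ≤ δ := by
        by_contra! hlt
        exact hx ⟨subset_closure hxΩ, hlt.le⟩
      simp [hh, hxΩ, hφ0 _ this]
    · simp [hh, hxΩ]
  have hon : ∀ x ∈ Ω, h =ᶠ[𝓝 x] fun x => φ (r x) * f x := fun x hx => by
    filter_upwards [hΩ.mem_nhds hx] with y hy
    simp [hh, hy]
  have hoff : ∀ x ∉ K, h =ᶠ[𝓝 x] fun _ => 0 := fun x hx => by
    filter_upwards [hKc.isClosed.isOpen_compl.mem_nhds hx] with y hy using hout y hy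
  have hC : ContDiff ℝ 1 h := by
    rw [contDiff_iff_contDiffAt]
    intro x
    by_cases hx : x ∈ Ω
    · have hrx := hr.contDiffAt (hΩ.mem_nhds hx)
      have hfx := hf.contDiffAt (hΩ.mem_nhds hx)
      exact ((hφ.contDiffAt.comp x hrx).mul hfx).congr_of_eventuallyEq (hon x hx)
    · exact contDiffAt_const.congr_of_eventuallyEq (hoff x fun hxK => hx (hKΩ hxK))
  have hsupp : HasCompactSupport h := HasCompactSupport.intro hKc hout
  have hzero : ∫ x, pd i h x = 0 := by
    have hd : Integrable fun x => fderiv ℝ h x (Pi.single i 1) :=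
      ((hC.continuous_fderiv one_ne_zero).clm_apply continuous_const).integrable_of_hasCompactSupport
        ((hsupp.fderiv ℝ).comp_left (g := fun L : (Fin n → ℝ) →L[ℝ] ℝ => L (Pi.single i 1)) rfl)
    have := integral_mul_fderiv_eq_neg_fderiv_mul_of_integrable (μ := volume) (𝕜 := ℝ)
      (f := fun _ : Fin n → ℝ => (1 : ℝ)) (g := h) (v := Pi.single i 1) (by simp)
      (by simpa using hd) (by simpa using hC.continuous.integrable_of_hasCompactSupport hsupp)
      (fun x _ => differentiableAt_const _) (fun x _ => hC.differentiable one_ne_zero x)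
    simpa [pd] using this
  have hpd : ∀ x ∉ Ω, pd i h x = 0 := fun x hx => by
    rw [pd, (hoff x fun hxK => hx (hKΩ hxK)).fderiv_eq]; simp
  rw [← setIntegral_eq_integral_of_forall_compl_eq_zero hpd] at hzero
  rw [← hzero]
  refine setIntegral_congr_fun hΩ.measurableSet fun x hx => ?_
  have hrx := ((hr.contDiffAt (hΩ.mem_nhds hx)).differentiableAt one_ne_zero).hasFDerivAt
  have hfx := ((hf.contDiffAt (hΩ.mem_nhds hx)).differentiableAt one_ne_zero).hasFDerivAt
  have hφx := ((hφ.differentiable one_ne_zero) (r x)).hasDerivAt.comp_hasFDerivAt x hrx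
  have hm : HasFDerivAt (fun x => φ (r x) * f x) _ x := hφx.mul hfx
  simp only [pd]
  rw [(hon x hx).fderiv_eq, hm.fderiv]
  simp only [add_apply, smul_apply, smul_eq_mul,
    Function.comp]
  ring

/-- The algebra of functions on `Ω` that extend smoothly to the closure of `Ω`. -/
def smoothOn {n : ℕ} (Ω : Set (Fin n → ℝ)) : Subalgebra ℝ (Ω → ℝ) where
  carrier := {f | ∃ F, ContDiffOn ℝ (⊤ : ℕ∞) F (closure Ω) ∧ ∀ x : Ω, f x = F x}
  mul_mem' := by
    rintro f g ⟨F, hF, hf⟩ ⟨G, hG, hg⟩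
    exact ⟨fun x => F x * G x, hF.mul hG, fun x => by simp [hf, hg]⟩
  add_mem' := by
    rintro f g ⟨F, hF, hf⟩ ⟨G, hG, hg⟩
    exact ⟨fun x => F x + G x, hF.add hG, fun x => by simp [hf, hg]⟩
  algebraMap_mem' := fun c => ⟨fun _ => c, contDiffOn_const, fun _ => rfl⟩

namespace smoothOn

variable {n : ℕ} {Ω : Set (Fin n → ℝ)}

/-- The restriction to `Ω` of a function smooth on the closure of `Ω`. -/
def restr (F : (Fin n → ℝ) → ℝ) (hF : ContDiffOn ℝ (⊤ : ℕ∞) F (closure Ω)) : smoothOn Ω :=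
  ⟨fun x => F x, F, hF, fun _ => rfl⟩

lemma exists_eq_restr (f : smoothOn Ω) :
    ∃ F, ∃ hF : ContDiffOn ℝ (⊤ : ℕ∞) F (closure Ω), f = restr F hF := by
  obtain ⟨f, F, hF, h⟩ := f
  exact ⟨F, hF, Subtype.ext (funext h)⟩

lemma differentiableAt (hΩ : IsOpen Ω) {F : (Fin n → ℝ) → ℝ}
    (hF : ContDiffOn ℝ (⊤ : ℕ∞) F (closure Ω)) {x : Fin n → ℝ} (hx : x ∈ Ω) :
    DifferentiableAt ℝ F x :=
  (hF.contDiffAt (Filter.mem_of_superset (hΩ.mem_nhds hx) subset_closure)).differentiableAt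
    (by simp)

lemma exists_eqOn_pd (hΩ : IsOpen Ω) (hU : UniqueDiffOn ℝ (closure Ω)) {F : (Fin n → ℝ) → ℝ}
    (hF : ContDiffOn ℝ (⊤ : ℕ∞) F (closure Ω)) (i : Fin n) :
    ContDiffOn ℝ (⊤ : ℕ∞) (fun x => fderivWithin ℝ F (closure Ω) x (Pi.single i 1)) (closure Ω) ∧
      ∀ x ∈ Ω, pd i F x = fderivWithin ℝ F (closure Ω) x (Pi.single i 1) := by
  refine ⟨(hF.fderivWithin hU (m := (⊤ : ℕ∞)) (by simp)).clm_apply contDiffOn_const, fun x hx => ?_⟩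
  rw [pd, fderivWithin_of_mem_nhds (Filter.mem_of_superset (hΩ.mem_nhds hx) subset_closure)]

/-- The partial derivatives as derivations of the algebra of smooth functions. -/
noncomputable def deriv (hΩ : IsOpen Ω) (hU : UniqueDiffOn ℝ (closure Ω)) (i : Fin n) :
    Derivation ℝ (smoothOn Ω) (smoothOn Ω) :=
  have key : ∀ (F : (Fin n → ℝ) → ℝ) (hF : ContDiffOn ℝ (⊤ : ℕ∞) F (closure Ω)) (x : Ω),
      pd i (Function.extend Subtype.val (restr F hF).1 0) x = pd i F x := fun F hF x =>
    pd_congr_of_eqOn hΩ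
      (fun y hy => Subtype.val_injective.extend_apply (restr F hF).1 0 (⟨y, hy⟩ : Ω)) i x.2
  Derivation.mk'
    { toFun := fun f => ⟨fun x => pd i (Function.extend Subtype.val f.1 0) x, by
        obtain ⟨F, hF, rfl⟩ := exists_eq_restr f
        obtain ⟨h1, h2⟩ := exists_eqOn_pd hΩ hU hF i
        exact ⟨_, h1, fun x => (key F hF x).trans (h2 x x.2)⟩⟩
      map_add' := fun f g => by
        obtain ⟨F, hF, rfl⟩ := exists_eq_restr f
        obtain ⟨G, hG, rfl⟩ := exists_eq_restr g
        refine Subtype.ext (funext fun x => ?_)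
        refine (key (fun y => F y + G y) (hF.add hG) x).trans ?_
        refine Eq.trans ?_ (congrArg₂ (· + ·) (key F hF x) (key G hG x)).symm
        simp only [pd]
        rw [fderiv_fun_add (differentiableAt hΩ hF x.2) (differentiableAt hΩ hG x.2)]
        rfl
      map_smul' := fun c f => by
        obtain ⟨F, hF, rfl⟩ := exists_eq_restr f
        refine Subtype.ext (funext fun x => ?_)
        refine (key (fun y => c • F y) (hF.const_smul c) x).trans ?_
        refine Eq.trans ?_ (congrArg (c • ·) (key F hF x)).symm
        simp only [pd]
        rw [fderiv_fun_const_smul (differentiableAt hΩ hF x.2)]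
        rfl }
    fun f g => by
      obtain ⟨F, hF, rfl⟩ := exists_eq_restr f
      obtain ⟨G, hG, rfl⟩ := exists_eq_restr g
      refine Subtype.ext (funext fun x => ?_)
      refine (key (fun y => F y * G y) (hF.mul hG) x).trans ?_
      refine Eq.trans ?_ (congrArg₂ (fun a b => F x * a + G x * b) (key G hG x) (key F hF x)).symm
      simp only [pd]
      rw [fderiv_fun_mul (differentiableAt hΩ hF x.2) (differentiableAt hΩ hG x.2)]
      rfl

lemma deriv_apply (hΩ : IsOpen Ω) (hU : UniqueDiffOn ℝ (closure Ω)) (i : Fin n)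
    (f : smoothOn Ω) {F : (Fin n → ℝ) → ℝ} (hf : ∀ x : Ω, f.1 x = F x) (x : Ω) :
    (deriv hΩ hU i f).1 x = pd i F x :=
  pd_congr_of_eqOn hΩ (fun y hy =>
    (Subtype.val_injective.extend_apply f.1 0 (⟨y, hy⟩ : Ω)).trans (hf ⟨y, hy⟩)) i x.2

lemma deriv_comm (hΩ : IsOpen Ω) (hU : UniqueDiffOn ℝ (closure Ω)) (i j : Fin n)
    (f : smoothOn Ω) :
    deriv hΩ hU i (deriv hΩ hU j f) = deriv hΩ hU j (deriv hΩ hU i f) := by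
  obtain ⟨F, hF, rfl⟩ := exists_eq_restr f
  refine Subtype.ext (funext fun x => ?_)
  have h1 := fun k => deriv_apply hΩ hU k (restr F hF) (F := F) fun _ => rfl
  rw [deriv_apply hΩ hU i _ (h1 j), deriv_apply hΩ hU j _ (h1 i)]
  have hx : closure Ω ∈ nhds x.1 := Filter.mem_of_superset (hΩ.mem_nhds x.2) subset_closure
  have hFx := hF.contDiffAt hx
  have hs : IsSymmSndFDerivAt ℝ F x.1 := hFx.isSymmSndFDerivAt
    (by rw [minSmoothness_of_isRCLikeNormedField]; norm_cast)
  have hd : DifferentiableAt ℝ (fderiv ℝ F) x.1 :=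
    (hFx.fderiv_right (m := 1) (by norm_cast)).differentiableAt (by simp)
  have h2 : ∀ k l, pd k (pd l F) x.1 = fderiv ℝ (fderiv ℝ F) x.1 (Pi.single k 1) (Pi.single l 1) := by
    intro k l
    have : pd l F = fun y => fderiv ℝ F y (Pi.single l 1) := rfl
    rw [this, pd, fderiv_clm_apply hd (by simp)]
    simp
  rw [h2, h2]
  exact hs _ _

lemma bdd (hΩb : Bornology.IsBounded Ω) (f : smoothOn Ω) : ∃ C, ∀ x, |f.1 x| ≤ C := by
  obtain ⟨F, hF, rfl⟩ := exists_eq_restr f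
  obtain ⟨C, hC⟩ := hΩb.isCompact_closure.exists_bound_of_continuousOn hF.continuousOn
  exact ⟨C, fun x => hC x (subset_closure x.2)⟩

lemma continuous (f : smoothOn Ω) : Continuous f.1 := by
  obtain ⟨F, hF, rfl⟩ := exists_eq_restr f
  exact (hF.continuousOn.mono subset_closure).domRestrict

/-- Evaluation at a point. -/
def ev (x : Ω) : smoothOn Ω →ₐ[ℝ] ℝ := (Pi.evalAlgHom ℝ (fun _ : Ω => ℝ) x).comp (smoothOn Ω).val

@[simp] lemma ev_apply (x : Ω) (f : smoothOn Ω) : ev x f = f.1 x := rfl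

lemma setIntegral_truncated (hΩ : IsOpen Ω) (hU : UniqueDiffOn ℝ (closure Ω))
    (hΩb : Bornology.IsBounded Ω) {r : (Fin n → ℝ) → ℝ}
    (hr : ContDiffOn ℝ (⊤ : ℕ∞) r (closure Ω)) (hr0 : ∀ x ∈ frontier Ω, r x = 0)
    (i : Fin n) (f : smoothOn Ω) {φ : ℝ → ℝ} (hφ : ContDiff ℝ 1 φ)
    (hφ0 : ∃ δ > 0, ∀ t ≤ δ, φ t = 0) :
    ∫ x : Ω, _root_.deriv φ (r x) * (deriv hΩ hU i (restr r hr) * f).1 x +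
      φ (r x) * (deriv hΩ hU i f).1 x ∂(volume.comap Subtype.val) = 0 := by
  obtain ⟨F, hF, rfl⟩ := exists_eq_restr f
  have h := setIntegral_truncated_eq_zero hΩ hΩb hr.continuousOn
    ((hr.mono subset_closure).of_le (by norm_cast)) hr0
    ((hF.mono subset_closure).of_le (by norm_cast)) i hφ hφ0
  rw [← integral_subtype_comap hΩ.measurableSet] at h
  rw [← h]
  refine integral_congr_ae (Filter.Eventually.of_forall fun x => ?_)
  have h1 := deriv_apply hΩ hU i (restr r hr) (F := r) (fun _ => rfl) x
  have h2 := deriv_apply hΩ hU i (restr F hF) (F := F) (fun _ => rfl) x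
  simp only [MulMemClass.coe_mul, Pi.mul_apply, h1, h2]
  rfl

end smoothOn

namespace smoothOn

variable {n : ℕ} {Ω : Set (Fin n → ℝ)}

lemma isFiniteMeasure (hΩ : IsOpen Ω) (hΩb : Bornology.IsBounded Ω) :
    IsFiniteMeasure (volume.comap (Subtype.val : Ω → Fin n → ℝ)) := by
  refine ⟨?_⟩
  rw [comap_subtype_coe_apply hΩ.measurableSet]
  simpa using hΩb.measure_lt_top

lemma integrable_of_continuousOn (hΩ : IsOpen Ω) (hΩb : Bornology.IsBounded Ω)
    {G : (Fin n → ℝ) → ℝ} (hG : ContinuousOn G (closure Ω)) :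
    Integrable (fun x : Ω => G x) (volume.comap Subtype.val) :=
  (integrableOn_iff_comap_subtypeVal hΩ.measurableSet).1
    ((hG.integrableOn_compact hΩb.isCompact_closure).mono_set subset_closure)

lemma aestronglyMeasurable (f : smoothOn Ω) :
    AEStronglyMeasurable f.1 (volume.comap Subtype.val) :=
  (continuous f).aestronglyMeasurable

/-- Nondegeneracy of a defining function near the boundary. -/
lemma exists_le_gradSq_add (hΩ : IsOpen Ω) (hU : UniqueDiffOn ℝ (closure Ω))
    (hΩb : Bornology.IsBounded Ω) {r : (Fin n → ℝ) → ℝ}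
    (hr : ContDiffOn ℝ (⊤ : ℕ∞) r (closure Ω)) (hrpos : ∀ x ∈ Ω, 0 < r x)
    (hr0 : ∀ x ∈ frontier Ω, r x = 0) (hrgrad : ∀ x ∈ frontier Ω, fderiv ℝ r x ≠ 0) :
    ∃ c > 0, ∀ x : Ω, c ≤ ∑ i, (deriv hΩ hU i (restr r hr)).1 x ^ 2 + r x := by
  set g : (Fin n → ℝ) → ℝ :=
    fun x => ∑ i, (fderivWithin ℝ r (closure Ω) x (Pi.single i 1)) ^ 2 + r x with hg
  have hgc : ContinuousOn g (closure Ω) :=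
    (continuousOn_finsetSum _ fun i _ =>
      (exists_eqOn_pd hΩ hU hr i).1.continuousOn.pow 2).add hr.continuousOn
  have hpos : ∀ x ∈ closure Ω, 0 < g x := by
    intro x hx
    have h0 : 0 ≤ ∑ i, (fderivWithin ℝ r (closure Ω) x (Pi.single i 1)) ^ 2 := by positivity
    by_cases hxΩ : x ∈ Ω
    · have := hrpos x hxΩ
      simp only [hg]; linarith
    have hf : x ∈ frontier Ω := ⟨hx, by rwa [hΩ.interior_eq]⟩
    have hd := hrgrad x hf
    have hdiff : DifferentiableAt ℝ r x := by
      by_contra h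
      exact hd (fderiv_zero_of_not_differentiableAt h)
    simp only [hg, hr0 x hf, add_zero]
    refine h0.lt_of_ne fun h => hd ?_
    rw [eq_comm, Finset.sum_eq_zero_iff_of_nonneg fun i _ => by positivity] at h
    rw [← hdiff.fderivWithin (hU x hx)]
    refine ContinuousLinearMap.coe_injective (LinearMap.pi_ext' fun i => LinearMap.ext_ring ?_)
    simpa using h i (Finset.mem_univ i)
  have hval : ∀ x : Ω, ∑ i, (deriv hΩ hU i (restr r hr)).1 x ^ 2 + r x = g x := by
    intro x
    simp only [hg]
    congr 1
    refine Finset.sum_congr rfl fun i _ => ?_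
    rw [deriv_apply hΩ hU i (restr r hr) (F := r) (fun _ => rfl),
      (exists_eqOn_pd hΩ hU hr i).2 x x.2]
  rcases (closure Ω).eq_empty_or_nonempty with he | hne
  · exact ⟨1, one_pos, fun x => absurd (subset_closure x.2) (by simp [he])⟩
  obtain ⟨y, hy, hmin⟩ := hΩb.isCompact_closure.exists_isMinOn hne hgc
  exact ⟨g y, hpos y hy, fun x => by rw [hval]; exact hmin (subset_closure x.2)⟩

lemma integrable_rpow (hΩ : IsOpen Ω) (hU : UniqueDiffOn ℝ (closure Ω))
    (hΩb : Bornology.IsBounded Ω) {r : (Fin n → ℝ) → ℝ}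
    (hr : ContDiffOn ℝ (⊤ : ℕ∞) r (closure Ω)) (hrpos : ∀ x ∈ Ω, 0 < r x)
    (hr0 : ∀ x ∈ frontier Ω, r x = 0) (hrgrad : ∀ x ∈ frontier Ω, fderiv ℝ r x ≠ 0)
    {s : ℝ} (hs : -1 < s) :
    Integrable (fun x : Ω => r x ^ s) (volume.comap Subtype.val) := by
  have := isFiniteMeasure hΩ hΩb
  set ρ : smoothOn Ω := restr r hr with hρ
  set p : smoothOn Ω := ∑ i, deriv hΩ hU i ρ * deriv hΩ hU i ρ with hp
  set q : smoothOn Ω := ∑ i, deriv hΩ hU i (deriv hΩ hU i ρ) with hq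
  obtain ⟨R, hR⟩ := bdd hΩb ρ
  obtain ⟨B₁, hB₁⟩ := bdd hΩb p
  obtain ⟨B₂, hB₂⟩ := bdd hΩb q
  obtain ⟨c, hc, hcp⟩ := exists_le_gradSq_add hΩ hU hΩb hr hrpos hr0 hrgrad
  have hpx : ∀ x : Ω, p.1 x = ∑ i, (deriv hΩ hU i ρ).1 x ^ 2 := fun x => by
    simp [hp, pow_two]
  refine integrable_rpow_of_truncated hs (continuous ρ).measurable (fun x => hrpos x x.2)
    (fun x => (le_abs_self _).trans (hR x)) (aestronglyMeasurable p) (aestronglyMeasurable q)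
    (fun x => (hB₁ x).trans (le_max_left _ B₂)) (fun x => (hB₂ x).trans (le_max_right B₁ _))
    (fun x => by rw [hpx]; positivity) hc (fun x => by rw [hpx]; exact hcp x) ?_
  intro φ hφ hφ0
  have hi : ∀ i, Integrable (fun x : Ω => _root_.deriv φ (r x) *
      (deriv hΩ hU i ρ * deriv hΩ hU i ρ).1 x +
      φ (r x) * (deriv hΩ hU i (deriv hΩ hU i ρ)).1 x) (volume.comap Subtype.val) := by
    intro i
    obtain ⟨F, hF, hF'⟩ := exists_eq_restr (deriv hΩ hU i ρ * deriv hΩ hU i ρ)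
    obtain ⟨G, hG, hG'⟩ := exists_eq_restr (deriv hΩ hU i (deriv hΩ hU i ρ))
    rw [hF', hG']
    exact integrable_of_continuousOn (G := fun x => _root_.deriv φ (r x) * F x + φ (r x) * G x)
      hΩ hΩb ((((hφ.continuous_deriv le_rfl).comp_continuousOn hr.continuousOn).mul
        hF.continuousOn).add ((hφ.continuous.comp_continuousOn hr.continuousOn).mul
        hG.continuousOn))
  have hsum := integral_finsetSum Finset.univ fun i _ => hi i
  rw [Finset.sum_eq_zero fun i _ => setIntegral_truncated hΩ hU hΩb hr hr0 i _ hφ hφ0] at hsum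
  rw [← hsum]
  refine integral_congr_ae (Filter.Eventually.of_forall fun x => ?_)
  simp only [hp, hq, Finset.sum_add_distrib, ← Finset.mul_sum]
  simp [hρ, restr]

lemma weighted_ibp (hΩ : IsOpen Ω) (hU : UniqueDiffOn ℝ (closure Ω))
    (hΩb : Bornology.IsBounded Ω) {r : (Fin n → ℝ) → ℝ}
    (hr : ContDiffOn ℝ (⊤ : ℕ∞) r (closure Ω)) (hrpos : ∀ x ∈ Ω, 0 < r x)
    (hr0 : ∀ x ∈ frontier Ω, r x = 0) (hrgrad : ∀ x ∈ frontier Ω, fderiv ℝ r x ≠ 0)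
    {s : ℝ} (hs : -1 < s) (i : Fin n) (f : smoothOn Ω) :
    ∫ x : Ω, r x ^ s * (r x * (deriv hΩ hU i f).1 x +
      (s + 1) * (deriv hΩ hU i (restr r hr) * f).1 x) ∂(volume.comap Subtype.val) = 0 := by
  obtain ⟨R, hR⟩ := bdd hΩb (restr r hr)
  obtain ⟨B₁, hB₁⟩ := bdd hΩb (deriv hΩ hU i (restr r hr) * f)
  obtain ⟨B₂, hB₂⟩ := bdd hΩb (deriv hΩ hU i f)
  exact integral_rpow_mul_eq_zero_of_truncated hs (continuous (restr r hr)).measurable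
    (fun x => hrpos x x.2) (integrable_rpow hΩ hU hΩb hr hrpos hr0 hrgrad hs)
    (fun x => (le_abs_self _).trans (hR x)) (aestronglyMeasurable _) (aestronglyMeasurable _)
    (fun x => (hB₁ x).trans (le_max_left _ B₂)) (fun x => (hB₂ x).trans (le_max_right B₁ _))
    fun φ hφ hφ0 => setIntegral_truncated hΩ hU hΩb hr hr0 i f hφ hφ0

end smoothOn

section
variable {Ω : Set (Fin 3 → ℝ)} {u : (Fin 3 → ℝ) → Fin 4 → ℝ}

lemma contDiffOn_Hcoef (hu : ∀ α, ContDiffOn ℝ (⊤ : ℕ∞) (fun x => u x α) (closure Ω))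
    (hu0 : ∀ x ∈ closure Ω, 0 < u x 0) (i j : Fin 3) :
    ContDiffOn ℝ (⊤ : ℕ∞) (Hcoef u i j) (closure Ω) :=
  contDiffOn_const.sub (((hu i.succ).mul (hu j.succ)).div ((hu 0).pow 2)
    fun x hx => (pow_pos (hu0 x hx) 2).ne')

lemma Hcoef_elliptic {x : Fin 3 → ℝ} (h0 : 0 < u x 0)
    (hn : -(u x 0) ^ 2 + (u x 1) ^ 2 + (u x 2) ^ 2 + (u x 3) ^ 2 = -1) (ξ : Fin 3 → ℝ) :
    1 / (u x 0) ^ 2 * ∑ i, ξ i ^ 2 ≤ ∑ i, ∑ j, Hcoef u i j x * (ξ i * ξ j) := by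
  have e : ∑ i, ∑ j, Hcoef u i j x * (ξ i * ξ j) =
      ∑ i, ξ i ^ 2 - (u x 1 * ξ 0 + u x 2 * ξ 1 + u x 3 * ξ 2) ^ 2 / (u x 0) ^ 2 := by
    have e2 : (Fin.succ 1 : Fin 4) = 2 := rfl
    have e3 : (Fin.succ 2 : Fin 4) = 3 := rfl
    have e1 : (Fin.succ 0 : Fin 4) = 1 := rfl
    simp only [Hcoef, Fin.sum_univ_three, e1, e2, e3]
    simp
    ring
  rw [e, le_sub_iff_add_le, ← sub_nonneg]
  have : ∑ i, ξ i ^ 2 - (1 / (u x 0) ^ 2 * ∑ i, ξ i ^ 2 +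
      (u x 1 * ξ 0 + u x 2 * ξ 1 + u x 3 * ξ 2) ^ 2 / (u x 0) ^ 2) =
      (((u x 0) ^ 2 - 1) * (ξ 0 ^ 2 + ξ 1 ^ 2 + ξ 2 ^ 2) -
        (u x 1 * ξ 0 + u x 2 * ξ 1 + u x 3 * ξ 2) ^ 2) / (u x 0) ^ 2 := by
    rw [Fin.sum_univ_three]; field_simp; ring
  rw [this]
  refine div_nonneg ?_ (by positivity)
  have h1 : (u x 0) ^ 2 - 1 = (u x 1) ^ 2 + (u x 2) ^ 2 + (u x 3) ^ 2 := by linarith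
  rw [h1]
  nlinarith [sq_nonneg (u x 1 * ξ 1 - u x 2 * ξ 0), sq_nonneg (u x 1 * ξ 2 - u x 3 * ξ 0),
    sq_nonneg (u x 2 * ξ 2 - u x 3 * ξ 1)]

open smoothOn in
/-- The weighted calculus of a domain with a defining function and a four-velocity field. -/
noncomputable def domainCalculus (hΩ : IsOpen Ω) (hΩb : Bornology.IsBounded Ω)
    (hU : UniqueDiffOn ℝ (closure Ω)) {r : (Fin 3 → ℝ) → ℝ}
    (hr : ContDiffOn ℝ (⊤ : ℕ∞) r (closure Ω)) (hrpos : ∀ x ∈ Ω, 0 < r x)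
    (hr0 : ∀ x ∈ frontier Ω, r x = 0) (hrgrad : ∀ x ∈ frontier Ω, fderiv ℝ r x ≠ 0)
    (hu : ∀ α, ContDiffOn ℝ (⊤ : ℕ∞) (fun x => u x α) (closure Ω))
    (hu0 : ∀ x ∈ closure Ω, 0 < u x 0)
    (hunorm : ∀ x ∈ closure Ω,
      -(u x 0) ^ 2 + (u x 1) ^ 2 + (u x 2) ^ 2 + (u x 3) ^ 2 = -1) :
    WeightedCalculus Ω (smoothOn Ω) where
  μ := volume.comap Subtype.val
  ev := ev
  D := deriv hΩ hU
  D_comm := deriv_comm hΩ hU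
  r := restr r hr
  r_pos := fun x => hrpos x x.2
  bdd := bdd hΩb
  meas := aestronglyMeasurable
  integ := fun _ hs => integrable_rpow hΩ hU hΩb hr hrpos hr0 hrgrad hs
  ibp := fun _ hs i f => weighted_ibp hΩ hU hΩb hr hrpos hr0 hrgrad hs i f
  grad := exists_le_gradSq_add hΩ hU hΩb hr hrpos hr0 hrgrad
  H := fun i j => restr (Hcoef u i j) (contDiffOn_Hcoef hu hu0 i j)
  H_symm := fun i j => Subtype.ext (funext fun x => by
    simp only [restr, Hcoef, eq_comm (a := i), mul_comm (u x i.succ)])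
  H_ell := by
    obtain ⟨M, hM⟩ := bdd hΩb (restr (fun x => u x 0) (hu 0))
    refine ⟨1 / (max M 1) ^ 2, by positivity, fun x ξ => le_trans ?_
      (Hcoef_elliptic (hu0 x (subset_closure x.2)) (hunorm x (subset_closure x.2)) ξ)⟩
    have hx0 := hu0 x (subset_closure x.2)
    have : u x 0 ≤ max M 1 := ((le_abs_self _).trans (hM x)).trans (le_max_left _ _)
    gcongr

end

lemma WeightedCalculus.I_J_eq_sum_words {X A : Type*} [MeasurableSpace X] [CommRing A]
    [Algebra ℝ A] (S : WeightedCalculus X A) {s : ℝ} (hs : -1 < s) (j : ℕ) (f : A) :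
    S.I s (S.J j f) = ∑ k ∈ Finset.range (j + 1), ∑ β : Fin k → Fin 3,
      S.I s (((List.ofFn β).foldr (fun i g => S.D i g) f) ^ 2) := by
  have hcomm : ∀ (w : List (Fin 3)) (i : Fin 3) (f : A), w.foldr (fun i g => S.D i g) (S.D i f) =
      S.D i (w.foldr (fun i g => S.D i g) f) := by
    intro w i f
    induction w with
    | nil => rfl
    | cons k w ih => simp only [List.foldr_cons, ih, S.D_comm k i]
  induction j generalizing f with
  | zero => simp [J]
  | succ j ih =>
    rw [S.I_J_succ hs, Finset.sum_range_succ', add_comm]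
    congr 1
    · simp only [ih]
      rw [Finset.sum_comm]
      refine Finset.sum_congr rfl fun k _ => ?_
      rw [← (Fin.consEquiv fun _ => Fin 3).sum_comp, Fintype.sum_prod_type]
      simp [Fin.consEquiv, hcomm]
    · simp

section
variable {Ω : Set (Fin 3 → ℝ)} {u : (Fin 3 → ℝ) → Fin 4 → ℝ}

open smoothOn in
lemma foldr_deriv_apply (hΩ : IsOpen Ω) (hU : UniqueDiffOn ℝ (closure Ω)) (f : smoothOn Ω)
    {F : (Fin 3 → ℝ) → ℝ} (hf : ∀ x : Ω, f.1 x = F x) (w : List (Fin 3)) (x : Ω) :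
    (w.foldr (fun i g => deriv hΩ hU i g) f).1 x = w.foldr pd F x := by
  induction w generalizing x with
  | nil => exact hf x
  | cons i w ih => exact deriv_apply hΩ hU i _ ih x

variable (hΩ : IsOpen Ω) (hΩb : Bornology.IsBounded Ω) (hU : UniqueDiffOn ℝ (closure Ω))
    {r : (Fin 3 → ℝ) → ℝ}
    (hr : ContDiffOn ℝ (⊤ : ℕ∞) r (closure Ω)) (hrpos : ∀ x ∈ Ω, 0 < r x)
    (hr0 : ∀ x ∈ frontier Ω, r x = 0) (hrgrad : ∀ x ∈ frontier Ω, fderiv ℝ r x ≠ 0)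
    (hu : ∀ α, ContDiffOn ℝ (⊤ : ℕ∞) (fun x => u x α) (closure Ω))
    (hu0 : ∀ x ∈ closure Ω, 0 < u x 0)
    (hunorm : ∀ x ∈ closure Ω,
      -(u x 0) ^ 2 + (u x 1) ^ 2 + (u x 2) ^ 2 + (u x 3) ^ 2 = -1)

lemma rSobNorm_eq_sqrt (f : smoothOn Ω) {F : (Fin 3 → ℝ) → ℝ} (hf : ∀ x : Ω, f.1 x = F x) (j : ℕ)
    {σ s : ℝ} (hσ : 2 * σ = s) (hs : -1 < s) :
    rSobNorm Ω r j σ F = Real.sqrt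
      ((domainCalculus hΩ hΩb hU hr hrpos hr0 hrgrad hu hu0 hunorm).I s
        ((domainCalculus hΩ hΩb hU hr hrpos hr0 hrgrad hu hu0 hunorm).J j f)) := by
  rw [WeightedCalculus.I_J_eq_sum_words _ hs, rSobNorm, hσ]
  congr 1
  refine Finset.sum_congr rfl fun k _ => Finset.sum_congr rfl fun β _ => ?_
  rw [← integral_subtype_comap hΩ.measurableSet]
  refine integral_congr_ae (Filter.Eventually.of_forall fun x => ?_)
  have := foldr_deriv_apply hΩ hU f hf (List.ofFn β) x
  simp only [map_pow]
  exact congrArg (fun t => r x ^ s * t ^ 2) this.symm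

open smoothOn in
lemma domainCalculus_L_apply (κ : ℝ) (f : smoothOn Ω) {F : (Fin 3 → ℝ) → ℝ}
    (hf : ∀ x : Ω, f.1 x = F x) (x : Ω) :
    (algebraMap ℝ (smoothOn Ω) (κ + 1) *
      (domainCalculus hΩ hΩb hU hr hrpos hr0 hrgrad hu hu0 hunorm).L (1 / κ) f).1 x =
      L1t κ r u F x := by
  have h1 : ∀ i, (deriv hΩ hU i f).1 x = pd i F x := fun i => deriv_apply hΩ hU i f hf x
  have h2 : ∀ i j, (deriv hΩ hU i (deriv hΩ hU j f)).1 x = pd i (pd j F) x := fun i j =>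
    deriv_apply hΩ hU i _ (fun y => deriv_apply hΩ hU j f hf y) x
  have h3 : ∀ i, (deriv hΩ hU i (restr r hr)).1 x = pd i r x := fun i =>
    deriv_apply hΩ hU i _ (fun _ => rfl) x
  rw [← ev_apply, WeightedCalculus.L, WeightedCalculus.P, WeightedCalculus.N]
  simp only [map_mul, map_add, map_sum, AlgHom.commutes, Algebra.algebraMap_self, RingHom.id_apply,
    ev_apply, domainCalculus, h1, h2, h3, L1t, Finset.mul_sum, ← Finset.sum_add_distrib]
  refine Finset.sum_congr rfl fun i _ => Finset.sum_congr rfl fun j _ => ?_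
  simp only [restr]
  ring

end

lemma WeightedCalculus.J_algebraMap_mul {X A : Type*} [MeasurableSpace X] [CommRing A]
    [Algebra ℝ A] (S : WeightedCalculus X A) (c : ℝ) (k : ℕ) (f : A) :
    S.J k (algebraMap ℝ A c * f) = algebraMap ℝ A (c ^ 2) * S.J k f := by
  induction k generalizing f with
  | zero => simp only [J, map_pow]; ring
  | succ k ih =>
    have : ∀ i, S.D i (algebraMap ℝ A c * f) = algebraMap ℝ A c * S.D i f := fun i => by simp
    simp only [J_succ, this, ih, ← Finset.mul_sum, map_pow]
    ring

/-- **High-order weighted elliptic estimate for `L̃₁`** (Lemma 3.12 of the paper): for every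
integer `l ≥ 1`,
`‖f‖_{H^{2l,1/(2κ)+l-1/2}} ≲ ‖L̃₁ f‖_{H^{2l-2,1/(2κ)+l-3/2}} + ‖f‖_{H^{0,1/(2κ)-1/2}}`. -/
theorem high_order_elliptic_estimate_L1 (Ω : Set (Fin 3 → ℝ))
    (hΩo : IsOpen Ω) (hΩb : Bornology.IsBounded Ω) (hΩs : HasSmoothBoundary Ω)
    (κ : ℝ) (hκ : 0 < κ)
    (r : (Fin 3 → ℝ) → ℝ) (hr : ContDiffOn ℝ (⊤ : ℕ∞) r (closure Ω))
    (hrpos : ∀ x ∈ Ω, 0 < r x) (hr0 : ∀ x ∈ frontier Ω, r x = 0)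
    (hrgrad : ∀ x ∈ frontier Ω, fderiv ℝ r x ≠ 0)
    (u : (Fin 3 → ℝ) → Fin 4 → ℝ)
    (hu : ∀ α, ContDiffOn ℝ (⊤ : ℕ∞) (fun x => u x α) (closure Ω))
    (hu0 : ∀ x ∈ closure Ω, 0 < u x 0)
    (hunorm : ∀ x ∈ closure Ω,
      -(u x 0) ^ 2 + (u x 1) ^ 2 + (u x 2) ^ 2 + (u x 3) ^ 2 = -1) :
    ∀ l : ℕ, 1 ≤ l → ∃ C > 0, ∀ f : (Fin 3 → ℝ) → ℝ,
      ContDiffOn ℝ (⊤ : ℕ∞) f (closure Ω) →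
      rSobNorm Ω r (2*l) (1/(2*κ) + l - 1/2) f
        ≤ C * (rSobNorm Ω r (2*l - 2) (1/(2*κ) + l - 3/2) (L1t κ r u f)
            + rSobNorm Ω r 0 (1/(2*κ) - 1/2) f) := by
  intro l hl
  obtain ⟨n, rfl⟩ := Nat.exists_eq_add_of_le' hl
  have hU := hΩs.uniqueDiffOn_closure hΩo
  have ha : 0 < 1 / κ := by positivity
  set S := domainCalculus hΩo hΩb hU hr hrpos hr0 hrgrad hu hu0 hunorm with hS
  obtain ⟨C, hC, hest⟩ := S.elliptic_estimate n ha
  refine ⟨Real.sqrt C, by positivity, fun f hf => ?_⟩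
  set g : smoothOn Ω := smoothOn.restr f hf
  have hg : ∀ x : Ω, g.1 x = f x := fun _ => rfl
  have hn : (0 : ℝ) ≤ n := n.cast_nonneg
  rw [rSobNorm_eq_sqrt hΩo hΩb hU hr hrpos hr0 hrgrad hu hu0 hunorm g hg (2 * (n + 1))
      (s := 1 / κ + 2 * n + 1) (by push_cast; field_simp; ring) (by linarith),
    rSobNorm_eq_sqrt hΩo hΩb hU hr hrpos hr0 hrgrad hu hu0 hunorm _
      (domainCalculus_L_apply hΩo hΩb hU hr hrpos hr0 hrgrad hu hu0 hunorm κ g hg) (2 * (n + 1) - 2)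
      (s := 1 / κ + 2 * n - 1) (by push_cast; field_simp; ring) (by linarith),
    rSobNorm_eq_sqrt hΩo hΩb hU hr hrpos hr0 hrgrad hu hu0 hunorm g hg 0
      (s := 1 / κ - 1) (by field_simp) (by linarith), ← hS, S.J_algebraMap_mul, S.I_smul]
  have h0 : S.J 0 g = g ^ 2 := rfl
  have h1 : 0 ≤ S.I (1 / κ + 2 * n - 1) (S.J (2 * n) (S.L (1 / κ) g)) := S.I_J_nonneg _ _ _
  have h2 : 0 ≤ S.I (1 / κ - 1) (S.J 0 g) := S.I_J_nonneg _ _ _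
  have h3 : 2 * (n + 1) - 2 = 2 * n := by omega
  have h4 := hest g
  rw [h3, Real.sqrt_mul (by positivity), Real.sqrt_sq (by positivity)]
  rw [← h0] at h4
  set a := S.I (1 / κ + 2 * n - 1) (S.J (2 * n) (S.L (1 / κ) g))
  set b := S.I (1 / κ - 1) (S.J 0 g)
  have h5 : Real.sqrt (a + b) ≤ Real.sqrt a + Real.sqrt b := by
    rw [Real.sqrt_le_left (by positivity)]
    nlinarith [Real.sq_sqrt h1, Real.sq_sqrt h2, Real.sqrt_nonneg a, Real.sqrt_nonneg b,
      mul_nonneg (Real.sqrt_nonneg a) (Real.sqrt_nonneg b)]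
  calc Real.sqrt _ ≤ Real.sqrt (C * (a + b)) := Real.sqrt_le_sqrt h4
    _ = Real.sqrt C * Real.sqrt (a + b) := Real.sqrt_mul hC.le _
    _ ≤ Real.sqrt C * ((κ + 1) * Real.sqrt a + Real.sqrt b) := by
      gcongr
      nlinarith [Real.sqrt_nonneg a]
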